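/- arXiv:2004.07220 — 4 statements merged into one kernel-verified Lean document; each statement's English description precedes it below -/
import Mathlib

section
/- Let g be a multiaffine homogeneous polynomial in n variables (each variable appears with degree at most 1 in every monomial, and all monomials have the same total degree) with nonnegative coefficients, and suppose g is log-concave on the nonnegative orthant. Then for any m ≥ 0 and any directions v_1, …, v_m ∈ [0,∞)^n, the polynomial ∂_{v_1} ⋯ ∂_{v_m} g is log-concave on the nonnegative orthant, where ∂_v f := ∑_{i=1}^n v_i · ∂f/∂z_i. -/
open Finset

/-- `g` is log-concave on the nonnegative orthant (using real powers). -/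
def LogConcaveOn {n : ℕ} (g : (Fin n → ℝ) → ℝ) : Prop :=
  ∀ x y : Fin n → ℝ, (∀ i, 0 ≤ x i) → (∀ i, 0 ≤ y i) →
    ∀ l : ℝ, 0 ≤ l → l ≤ 1 →
      g x ^ l * g y ^ (1 - l) ≤ g (fun i => l * x i + (1 - l) * y i)

/-- The directional derivative `∂_v f = ∑ i, v i • ∂f/∂z_i` of a multivariate polynomial. -/
noncomputable def dirDeriv {n : ℕ} (v : Fin n → ℝ) (f : MvPolynomial (Fin n) ℝ) :
    MvPolynomial (Fin n) ℝ :=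
  ∑ i, MvPolynomial.C (v i) * MvPolynomial.pderiv i f

section Lorentzian

open Matrix

variable {ι : Type*} [Fintype ι]

/-- The reversed Cauchy–Schwarz inequality for the quadratic form of `A` against the vector `w`. -/
def ReverseCauchySchwarz (A : Matrix ι ι ℝ) (w : ι → ℝ) : Prop :=
  ∀ x, (x ⬝ᵥ A *ᵥ x) * (w ⬝ᵥ A *ᵥ w) ≤ (x ⬝ᵥ A *ᵥ w) ^ 2

theorem dotProduct_mulVec_comm {A : Matrix ι ι ℝ} (hA : A.IsSymm) (x y : ι → ℝ) :
    x ⬝ᵥ A *ᵥ y = y ⬝ᵥ A *ᵥ x := by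
  rw [dotProduct_mulVec, ← mulVec_transpose, hA.eq, dotProduct_comm]

theorem quadratic_add_smul {A : Matrix ι ι ℝ} (hA : A.IsSymm) (x y : ι → ℝ) (s : ℝ) :
    (x + s • y) ⬝ᵥ A *ᵥ (x + s • y) =
      x ⬝ᵥ A *ᵥ x + 2 * s * (x ⬝ᵥ A *ᵥ y) + s ^ 2 * (y ⬝ᵥ A *ᵥ y) := by
  simp only [mulVec_add, mulVec_smul, add_dotProduct, dotProduct_add, smul_dotProduct,
    dotProduct_smul, smul_eq_mul, dotProduct_mulVec_comm hA y x]
  ring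

theorem reverseCauchySchwarz_of_orthogonal {A : Matrix ι ι ℝ} (hA : A.IsSymm) {w : ι → ℝ}
    (hw : 0 ≤ w ⬝ᵥ A *ᵥ w) (h : ∀ x, x ⬝ᵥ A *ᵥ w = 0 → x ⬝ᵥ A *ᵥ x ≤ 0) :
    ReverseCauchySchwarz A w := by
  intro x
  rcases hw.eq_or_lt with hw | hw
  · rw [← hw, mul_zero]; positivity
  set s := -(x ⬝ᵥ A *ᵥ w) / (w ⬝ᵥ A *ᵥ w) with hs
  have hsw : s * (w ⬝ᵥ A *ᵥ w) = -(x ⬝ᵥ A *ᵥ w) := by rw [hs]; field_simp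
  have key := h (x + s • w) (by
    rw [add_dotProduct, smul_dotProduct, smul_eq_mul, hsw]; ring)
  rw [quadratic_add_smul hA] at key
  have := mul_nonpos_of_nonpos_of_nonneg key hw.le
  nlinarith

theorem ReverseCauchySchwarz.change {A : Matrix ι ι ℝ} (hA : A.IsSymm) {v w : ι → ℝ}
    (h : ReverseCauchySchwarz A v) (hv : 0 < v ⬝ᵥ A *ᵥ v) (hw : 0 ≤ w ⬝ᵥ A *ᵥ w) :
    ReverseCauchySchwarz A w := by
  rcases hw.eq_or_lt with hw | hw
  · intro x
    rw [← hw, mul_zero]; positivity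
  refine reverseCauchySchwarz_of_orthogonal hA hw.le fun x hx => ?_
  by_contra! hpos
  have hxv := h x
  set a := x ⬝ᵥ A *ᵥ v with ha
  set b := w ⬝ᵥ A *ᵥ v with hb
  have ha2 : 0 < a ^ 2 := lt_of_lt_of_le (mul_pos hpos hv) hxv
  have ha0 : a ≠ 0 := by rintro h0; simp [h0] at ha2
  have hcomb := h (w + (-b / a) • x)
  have h0 : (w + (-b / a) • x) ⬝ᵥ A *ᵥ v = 0 := by
    rw [add_dotProduct, smul_dotProduct, smul_eq_mul, ← ha, ← hb]; field_simp; ring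
  rw [h0, quadratic_add_smul hA, dotProduct_mulVec_comm hA w x, hx] at hcomb
  have : 0 < w ⬝ᵥ A *ᵥ w + (-b / a) ^ 2 * (x ⬝ᵥ A *ᵥ x) := by positivity
  have := mul_pos this hv
  linarith

theorem quadratic_nonpos_of_orthogonal_eigenvectors [DecidableEq ι] {B : Matrix ι ι ℝ}
    (hB : B.IsHermitian) {y : ι → ℝ}
    (h : ∀ (z : ι → ℝ) (l : ℝ), z ≠ 0 → 0 < l → B *ᵥ z = l • z → z ⬝ᵥ y = 0) :
    y ⬝ᵥ B *ᵥ y ≤ 0 := by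
  have hinner : ∀ a b : ι → ℝ, inner ℝ (WithLp.toLp 2 a) (WithLp.toLp 2 b) = a ⬝ᵥ b := by
    intro a b
    simp [EuclideanSpace.inner_eq_star_dotProduct, dotProduct_comm]
  rw [← hinner, ← OrthonormalBasis.sum_inner_mul_inner hB.eigenvectorBasis]
  refine Finset.sum_nonpos fun i _ => ?_
  set z := (hB.eigenvectorBasis i).ofLp with hz
  have hz' : hB.eigenvectorBasis i = WithLp.toLp 2 z := rfl
  have heig : B *ᵥ z = hB.eigenvalues i • z := hB.mulVec_eigenvectorBasis i
  rw [hz', hinner, hinner, dotProduct_mulVec_comm (by simpa using hB), heig, dotProduct_smul,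
    smul_eq_mul, dotProduct_comm y z]
  rcases le_or_gt (hB.eigenvalues i) 0 with hl | hl
  · nlinarith [mul_self_nonneg (z ⬝ᵥ y)]
  · rw [h z _ ?_ hl heig]
    · simp
    · intro h0
      apply hB.eigenvectorBasis.toBasis.ne_zero i
      simp [hz', h0]

theorem eq_of_reverseCauchySchwarz_of_constant_on_edges {M : Matrix ι ι ℝ} (hM : ∀ i j, 0 ≤ M i j)
    {w : ι → ℝ} (hw : ∀ i, 0 < w i) (h : ReverseCauchySchwarz M w) {c : ι → ℝ}
    (hc : ∀ i j, M i j ≠ 0 → c i = c j) {i j : ι} (hi : (M *ᵥ w) i ≠ 0) (hj : (M *ᵥ w) j ≠ 0) :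
    c i = c j := by
  set r : ι → ℝ := fun i => w i * (M *ᵥ w) i with hr
  have hMw : ∀ i, 0 ≤ (M *ᵥ w) i := fun i =>
    Finset.sum_nonneg fun j _ => mul_nonneg (hM i j) (hw j).le
  have hr0 : ∀ i, 0 ≤ r i := fun i => mul_nonneg (hw i).le (hMw i)
  have hri : ∀ i, (M *ᵥ w) i ≠ 0 → 0 < r i := fun i hi =>
    mul_pos (hw i) (lt_of_le_of_ne (hMw i) hi.symm)
  have hcM : ∀ i, (M *ᵥ fun j => c j * w j) i = c i * (M *ᵥ w) i := by
    intro i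
    simp only [mulVec, dotProduct, Finset.mul_sum]
    refine Finset.sum_congr rfl fun j _ => ?_
    by_cases hij : M i j = 0
    · simp [hij]
    · rw [hc i j hij]; ring
  have key := h fun j => c j * w j
  have e1 : (fun j => c j * w j) ⬝ᵥ (M *ᵥ fun j => c j * w j) = ∑ i, r i * c i ^ 2 := by
    simp only [dotProduct]
    exact Finset.sum_congr rfl fun i _ => by rw [hcM]; ring
  have e2 : (fun j => c j * w j) ⬝ᵥ (M *ᵥ w) = ∑ i, r i * c i := by
    simp only [dotProduct]
    exact Finset.sum_congr rfl fun i _ => by ring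
  have e3 : w ⬝ᵥ (M *ᵥ w) = ∑ i, r i := rfl
  rw [e1, e2, e3] at key
  have hR : 0 < ∑ i, r i := Finset.sum_pos' (fun i _ => hr0 i) ⟨i, Finset.mem_univ _, hri i hi⟩
  set R := ∑ i, r i with hRdef
  set m := (∑ i, r i * c i) / R with hm
  have hmR : ∑ i, r i * c i = m * R := by rw [hm]; field_simp
  have hvar : ∑ i, r i * (c i - m) ^ 2 ≤ 0 := by
    have : ∑ i, r i * (c i - m) ^ 2 = ∑ i, r i * c i ^ 2 - m ^ 2 * R := by
      have : ∑ i, r i * (c i - m) ^ 2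
          = ∑ i, r i * c i ^ 2 - 2 * m * ∑ i, r i * c i + m ^ 2 * R := by
        rw [hRdef, Finset.mul_sum, Finset.mul_sum, ← Finset.sum_sub_distrib,
          ← Finset.sum_add_distrib]
        exact Finset.sum_congr rfl fun i _ => by ring
      rw [this, hmR]; ring
    rw [this]
    rw [hmR] at key
    have : (∑ i, r i * c i ^ 2) * R ≤ (m ^ 2 * R) * R := by linarith
    linarith [le_of_mul_le_mul_right this hR]
  have hzero := (Finset.sum_eq_zero_iff_of_nonneg
    (fun i _ => mul_nonneg (hr0 i) (sq_nonneg (c i - m)))).1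
    (le_antisymm hvar (Finset.sum_nonneg fun i _ => mul_nonneg (hr0 i) (sq_nonneg (c i - m))))
  have hm' : ∀ i, (M *ᵥ w) i ≠ 0 → c i = m := by
    intro i hi
    have := hzero i (Finset.mem_univ _)
    rcases mul_eq_zero.1 this with h | h
    · exact absurd h (hri i hi).ne'
    · exact sub_eq_zero.1 (pow_eq_zero_iff two_ne_zero |>.1 h)
  rw [hm' i hi, hm' j hj]

/-- The quadratic form of the weighted graph Laplacian of `A`. -/
theorem sum_mul_sub_sq {A : Matrix ι ι ℝ} (hA : A.IsSymm) {w : ι → ℝ} (hw : ∀ i, 0 < w i)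
    (x : ι → ℝ) :
    ∑ i, ∑ j, A i j * w i * w j * (x i / w i - x j / w j) ^ 2 =
      2 * (∑ i, (A *ᵥ w) i * x i ^ 2 / w i - x ⬝ᵥ A *ᵥ x) := by
  have h1 : ∑ i, ∑ j, A i j * w j * (x i ^ 2 / w i) = ∑ i, (A *ᵥ w) i * x i ^ 2 / w i := by
    refine Finset.sum_congr rfl fun i _ => ?_
    rw [mul_div_assoc, mulVec, dotProduct, Finset.sum_mul]
  have h2 : ∑ i, ∑ j, A i j * w i * (x j ^ 2 / w j) = ∑ i, (A *ᵥ w) i * x i ^ 2 / w i := by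
    rw [← h1, Finset.sum_comm]
    exact Finset.sum_congr rfl fun i _ => Finset.sum_congr rfl fun j _ => by rw [hA.apply]
  have h3 : ∑ i, ∑ j, x i * (A i j * x j) = x ⬝ᵥ A *ᵥ x := by
    simp only [mulVec, dotProduct, Finset.mul_sum]
  have : 2 * (∑ i, (A *ᵥ w) i * x i ^ 2 / w i - x ⬝ᵥ A *ᵥ x) =
      ∑ i, ∑ j, A i j * w j * (x i ^ 2 / w i) + ∑ i, ∑ j, A i j * w i * (x j ^ 2 / w j)
      - 2 * ∑ i, ∑ j, x i * (A i j * x j) := by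
    rw [h1, h2, h3]; ring
  rw [this]
  simp only [Finset.mul_sum, ← Finset.sum_add_distrib, ← Finset.sum_sub_distrib]
  refine Finset.sum_congr rfl fun i _ => Finset.sum_congr rfl fun j _ => ?_
  have := (hw i).ne'
  have := (hw j).ne'
  field_simp
  ring

theorem ReverseCauchySchwarz.of_slices {A : Matrix ι ι ℝ} (hA : A.IsSymm)
    (hA0 : ∀ i j, 0 ≤ A i j) {w : ι → ℝ} (hw : ∀ i, 0 < w i) {Q : ι → Matrix ι ι ℝ}
    (hQ0 : ∀ k i j, 0 ≤ Q k i j)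
    (hQw : ∀ k, Q k *ᵥ w = A k) (hQA : ∑ k, w k • Q k = A)
    (hQ : ∀ k, ReverseCauchySchwarz (Q k) w)
    (hconn : ∀ c : ι → ℝ, (∀ i j, A i j ≠ 0 → c i = c j) →
      ∀ i j, (A *ᵥ w) i ≠ 0 → (A *ᵥ w) j ≠ 0 → c i = c j) :
    ReverseCauchySchwarz A w := by
  classical
  set p := A *ᵥ w with hp
  have hp0 : ∀ i, 0 ≤ p i := fun i =>
    Finset.sum_nonneg fun j _ => mul_nonneg (hA0 i j) (hw j).le
  have hrow : ∀ i, p i = 0 → ∀ j, A i j = 0 := by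
    intro i hi j
    have := (Finset.sum_eq_zero_iff_of_nonneg
      (fun j _ => mul_nonneg (hA0 i j) (hw j).le)).1 hi j (Finset.mem_univ _)
    exact (mul_eq_zero.1 this).resolve_right (hw j).ne'
  have hQrow : ∀ k, p k = 0 → Q k = 0 := by
    intro k hk
    ext i j
    have h0 : (Q k *ᵥ w) i = 0 := by rw [hQw]; exact hrow k hk i
    have := (Finset.sum_eq_zero_iff_of_nonneg
      (fun j _ => mul_nonneg (hQ0 k i j) (hw j).le)).1 h0 j (Finset.mem_univ _)
    exact (mul_eq_zero.1 this).resolve_right (hw j).ne'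
  have hquad : ∀ x, x ⬝ᵥ A *ᵥ x ≤ ∑ k, w k / p k * (A *ᵥ x) k ^ 2 := by
    intro x
    have hsum : x ⬝ᵥ A *ᵥ x = ∑ k, w k * (x ⬝ᵥ Q k *ᵥ x) := by
      conv_lhs => rw [← hQA]
      simp only [Matrix.sum_mulVec, dotProduct_sum, smul_mulVec, dotProduct_smul, smul_eq_mul]
    rw [hsum]
    refine Finset.sum_le_sum fun k _ => ?_
    by_cases hk : p k = 0
    · simp [hQrow k hk, hk]
    have hpk : 0 < p k := lt_of_le_of_ne (hp0 k) (Ne.symm hk)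
    have h1 : x ⬝ᵥ Q k *ᵥ w = (A *ᵥ x) k := by
      rw [hQw, dotProduct_comm]; rfl
    have h2 : w ⬝ᵥ Q k *ᵥ w = p k := by
      rw [hQw, dotProduct_comm]; rfl
    have h3 := hQ k x
    rw [h1, h2] at h3
    rw [div_mul_eq_mul_div, mul_div_assoc]
    exact mul_le_mul_of_nonneg_left ((le_div_iff₀ hpk).2 h3) (hw k).le
  set s : ι → ℝ := fun k => √(w k / p k) with hs
  have hs2 : ∀ k, s k ^ 2 = w k / p k := fun k => Real.sq_sqrt (div_nonneg (hw k).le (hp0 k))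
  have hs0 : ∀ k, p k ≠ 0 → s k ≠ 0 := fun k hk =>
    (Real.sqrt_pos.2 (div_pos (hw k) (lt_of_le_of_ne (hp0 k) (Ne.symm hk)))).ne'
  set B : Matrix ι ι ℝ := Matrix.of fun i j => s i * A i j * s j with hBdef
  have hBv : ∀ z i, (B *ᵥ z) i = s i * (A *ᵥ fun j => s j * z j) i := by
    intro z i
    simp only [hBdef, mulVec, dotProduct, Matrix.of_apply, Finset.mul_sum]
    exact Finset.sum_congr rfl fun j _ => by ring
  have hBquad : ∀ z, z ⬝ᵥ B *ᵥ z = (fun j => s j * z j) ⬝ᵥ A *ᵥ fun j => s j * z j := by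
    intro z
    simp only [dotProduct, hBv]
    exact Finset.sum_congr rfl fun j _ => by ring
  have hB : B.IsHermitian := by
    ext i j
    simp only [hBdef, conjTranspose_apply, Matrix.of_apply, star_trivial]
    rw [hA.apply]; ring
  refine reverseCauchySchwarz_of_orthogonal hA
    (Finset.sum_nonneg fun i _ => mul_nonneg (hw i).le (hp0 i)) fun x hx => ?_
  have hAcongr : ∀ {a b : ι → ℝ}, (∀ j, p j ≠ 0 → a j = b j) →
      a ⬝ᵥ A *ᵥ a = b ⬝ᵥ A *ᵥ b := by
    intro a b hab
    simp only [dotProduct, mulVec, Finset.mul_sum]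
    refine Finset.sum_congr rfl fun i _ => Finset.sum_congr rfl fun j _ => ?_
    by_cases hi : p i = 0
    · simp [hrow i hi]
    by_cases hj : p j = 0
    · rw [← hA.apply]; simp [hrow j hj]
    rw [hab i hi, hab j hj]
  set y : ι → ℝ := fun j => x j / s j with hy
  have hxy : x ⬝ᵥ A *ᵥ x = y ⬝ᵥ B *ᵥ y := by
    rw [hBquad]
    refine hAcongr fun j hj => ?_
    have := hs0 j hj
    simp only [hy]; field_simp
  rw [hxy]
  refine quadratic_nonpos_of_orthogonal_eigenvectors hB fun z l hz hl hzl => ?_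
  set t : ι → ℝ := fun j => s j * z j with ht
  have hzz : 0 < z ⬝ᵥ z := by
    have := dotProduct_star_self_pos_iff.2 hz
    simpa using this
  have htAt : t ⬝ᵥ A *ᵥ t = l * (z ⬝ᵥ z) := by
    rw [← hBquad, hzl, dotProduct_smul, smul_eq_mul]
  have hle : l * (z ⬝ᵥ z) ≤ l * (l * (z ⬝ᵥ z)) := by
    refine (htAt.ge.trans (hquad t)).trans (le_of_eq ?_)
    simp only [dotProduct, Finset.mul_sum]
    refine Finset.sum_congr rfl fun k _ => ?_
    have h1 : s k * (A *ᵥ t) k = l * z k := by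
      rw [← hBv, hzl]; rfl
    rw [← hs2, ← mul_pow, h1]; ring
  have hl1 : z ⬝ᵥ z ≤ l * (z ⬝ᵥ z) := le_of_mul_le_mul_left hle hl
  have hterm : ∀ i j, 0 ≤ A i j * w i * w j * (t i / w i - t j / w j) ^ 2 := fun i j =>
    mul_nonneg (mul_nonneg (mul_nonneg (hA0 i j) (hw i).le) (hw j).le) (sq_nonneg _)
  have hlap : ∑ i, ∑ j, A i j * w i * w j * (t i / w i - t j / w j) ^ 2 ≤ 0 := by
    rw [sum_mul_sub_sq hA hw, htAt]
    have : ∑ i, p i * t i ^ 2 / w i ≤ z ⬝ᵥ z := by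
      refine Finset.sum_le_sum fun i _ => ?_
      by_cases hi : p i = 0
      · simp only [hi, zero_mul, zero_div]; exact mul_self_nonneg _
      · have := (hw i).ne'
        simp only [ht, mul_pow, hs2]
        apply le_of_eq
        field_simp
    linarith
  have hedge : ∀ i j, A i j ≠ 0 → t i / w i = t j / w j := by
    intro i j hij
    have h1 := (Finset.sum_eq_zero_iff_of_nonneg
      (fun i _ => Finset.sum_nonneg fun j _ => hterm i j)).1
      (le_antisymm hlap (Finset.sum_nonneg fun i _ => Finset.sum_nonneg fun j _ => hterm i j))
      i (Finset.mem_univ _)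
    have h2 := (Finset.sum_eq_zero_iff_of_nonneg (fun j _ => hterm i j)).1 h1 j
      (Finset.mem_univ _)
    have h3 := (mul_eq_zero.1 h2).resolve_left
      (mul_ne_zero (mul_ne_zero hij (hw i).ne') (hw j).ne')
    exact sub_eq_zero.1 (pow_eq_zero_iff two_ne_zero |>.1 h3)
  have hconst := hconn (fun i => t i / w i) hedge
  obtain ⟨c, hc⟩ : ∃ c, ∀ i, p i ≠ 0 → t i / w i = c := by
    by_cases hex : ∃ i, p i ≠ 0
    · obtain ⟨i, hi⟩ := hex
      exact ⟨t i / w i, fun j hj => hconst j i hj hi⟩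
    · push Not at hex
      exact ⟨0, fun i hi => absurd (hex i) hi⟩
  have hsum : z ⬝ᵥ y = c * (x ⬝ᵥ p) := by
    simp only [dotProduct, Finset.mul_sum]
    refine Finset.sum_congr rfl fun i _ => ?_
    by_cases hi : p i = 0
    · simp [hy, hs, hi]
    · have hsi := hs0 i hi
      have hwi := (hw i).ne'
      have h1 := hc i hi
      have h2 := hs2 i
      rw [div_eq_iff hwi] at h1
      rw [eq_div_iff hi] at h2
      simp only [hy, ht] at h1 ⊢
      field_simp
      refine mul_right_cancel₀ hsi ?_
      linear_combination x i * h1 - c * x i * h2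
  rw [hsum, hx, mul_zero]

end Lorentzian

section NonnegCoeff

open MvPolynomial

variable {n k : ℕ} {f g : MvPolynomial (Fin n) ℝ}

theorem pderiv_comm {R σ : Type*} [CommSemiring R] (i j : σ) (f : MvPolynomial σ R) :
    pderiv i (pderiv j f) = pderiv j (pderiv i f) := by
  classical
  ext m
  simp only [coeff_pderiv, Finsupp.add_apply, Finsupp.single_apply]
  rw [add_right_comm]
  rcases eq_or_ne i j with rfl | hij
  · rfl
  · simp only [hij, hij.symm, if_false, add_zero]; ring

theorem pderiv_dirDeriv (i : Fin n) (v : Fin n → ℝ) (f : MvPolynomial (Fin n) ℝ) :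
    pderiv i (dirDeriv v f) = dirDeriv v (pderiv i f) := by
  simp only [dirDeriv, map_sum, pderiv_C_mul, pderiv_comm i]

theorem pderiv_foldr_dirDeriv (i : Fin n) (vs : List (Fin n → ℝ)) (f : MvPolynomial (Fin n) ℝ) :
    pderiv i (vs.foldr dirDeriv f) = vs.foldr dirDeriv (pderiv i f) := by
  induction vs with
  | nil => rfl
  | cons v vs ih => rw [List.foldr_cons, List.foldr_cons, pderiv_dirDeriv, ih]

theorem eval_dirDeriv (w v : Fin n → ℝ) (f : MvPolynomial (Fin n) ℝ) :
    eval w (dirDeriv v f) = ∑ i, v i * eval w (pderiv i f) := by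
  simp [dirDeriv]

theorem dirDeriv_zero (v : Fin n → ℝ) : dirDeriv v (0 : MvPolynomial (Fin n) ℝ) = 0 := by
  simp [dirDeriv]

theorem coeff_pderiv_nonneg (hf : ∀ m, 0 ≤ f.coeff m) (i : Fin n) (m : Fin n →₀ ℕ) :
    0 ≤ (pderiv i f).coeff m := by
  rw [coeff_pderiv]
  exact mul_nonneg (hf _) (by positivity)

theorem coeff_dirDeriv_nonneg (hf : ∀ m, 0 ≤ f.coeff m) {v : Fin n → ℝ} (hv : ∀ i, 0 ≤ v i)
    (m : Fin n →₀ ℕ) : 0 ≤ (dirDeriv v f).coeff m := by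
  rw [dirDeriv, coeff_sum]
  refine Finset.sum_nonneg fun i _ => ?_
  rw [coeff_C_mul]
  exact mul_nonneg (hv i) (coeff_pderiv_nonneg hf i m)

theorem coeff_foldr_dirDeriv_nonneg (hf : ∀ m, 0 ≤ f.coeff m) {vs : List (Fin n → ℝ)}
    (hvs : ∀ v ∈ vs, ∀ i, 0 ≤ v i) (m : Fin n →₀ ℕ) : 0 ≤ (vs.foldr dirDeriv f).coeff m := by
  induction vs generalizing m with
  | nil => exact hf m
  | cons v vs ih =>
    exact coeff_dirDeriv_nonneg (ih fun u hu => hvs u (List.mem_cons_of_mem v hu))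
      (hvs v List.mem_cons_self) m

theorem isHomogeneous_dirDeriv (hf : f.IsHomogeneous k) (v : Fin n → ℝ) :
    (dirDeriv v f).IsHomogeneous (k - 1) :=
  IsHomogeneous.sum _ _ _ fun i _ => by
    simpa using (isHomogeneous_C _ (v i)).mul (hf.pderiv (i := i))

theorem isHomogeneous_foldr_dirDeriv (hf : f.IsHomogeneous k) (vs : List (Fin n → ℝ)) :
    (vs.foldr dirDeriv f).IsHomogeneous (k - vs.length) := by
  induction vs with
  | nil => simpa using hf
  | cons v vs ih => simpa [Nat.sub_sub] using isHomogeneous_dirDeriv ih v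

theorem eval_nonneg_of_coeff_nonneg (hf : ∀ m, 0 ≤ f.coeff m) {w : Fin n → ℝ}
    (hw : ∀ i, 0 ≤ w i) : 0 ≤ eval w f := by
  rw [eval_eq]
  exact Finset.sum_nonneg fun m _ =>
    mul_nonneg (hf m) (Finset.prod_nonneg fun i _ => pow_nonneg (hw i) _)

theorem eval_pos_of_coeff_nonneg (hf : ∀ m, 0 ≤ f.coeff m) (hf0 : f ≠ 0) {w : Fin n → ℝ}
    (hw : ∀ i, 0 < w i) : 0 < eval w f := by
  obtain ⟨m, hm⟩ := support_nonempty.2 hf0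
  rw [eval_eq]
  exact Finset.sum_pos' (fun m _ =>
      mul_nonneg (hf m) (Finset.prod_nonneg fun i _ => pow_nonneg (hw i).le _))
    ⟨m, hm, mul_pos (lt_of_le_of_ne (hf m) (mem_support_iff.1 hm).symm)
      (Finset.prod_pos fun i _ => pow_pos (hw i) _)⟩

/-- Euler's identity for homogeneous polynomials. -/
theorem eval_dirDeriv_self (hf : f.IsHomogeneous k) (w : Fin n → ℝ) :
    eval w (dirDeriv w f) = k * eval w f := by
  have := congrArg (eval w) hf.sum_X_mul_pderiv
  simpa [eval_dirDeriv] using this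

theorem dirDeriv_ne_zero (hf : ∀ m, 0 ≤ f.coeff m) (hf0 : f ≠ 0) (hhom : f.IsHomogeneous k)
    (hk : k ≠ 0) {v : Fin n → ℝ} (hv : ∀ i, 0 < v i) : dirDeriv v f ≠ 0 := by
  intro h
  have := eval_dirDeriv_self hhom v
  rw [h, map_zero] at this
  have := eval_pos_of_coeff_nonneg hf hf0 hv
  have : (k : ℝ) ≠ 0 := by exact_mod_cast hk
  simp_all

theorem pderiv_eq_zero_of_isHomogeneous_zero (hf : f.IsHomogeneous 0) (i : Fin n) :
    pderiv i f = 0 := by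
  rw [(totalDegree_eq_zero_iff_eq_C.1 (Nat.le_zero.1 hf.totalDegree_le)), pderiv_C]

/-- The Hessian matrix of `f` at `w`. -/
noncomputable def hessian (f : MvPolynomial (Fin n) ℝ) (w : Fin n → ℝ) :
    Matrix (Fin n) (Fin n) ℝ :=
  Matrix.of fun i j => eval w (pderiv i (pderiv j f))

open Matrix

theorem hessian_apply (f : MvPolynomial (Fin n) ℝ) (w : Fin n → ℝ) (i j : Fin n) :
    hessian f w i j = eval w (pderiv i (pderiv j f)) := rfl

theorem hessian_isSymm (f : MvPolynomial (Fin n) ℝ) (w : Fin n → ℝ) : (hessian f w).IsSymm := by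
  ext i j
  rw [transpose_apply, hessian_apply, hessian_apply, pderiv_comm]

theorem hessian_nonneg (hf : ∀ m, 0 ≤ f.coeff m) {w : Fin n → ℝ} (hw : ∀ i, 0 ≤ w i)
    (i j : Fin n) : 0 ≤ hessian f w i j :=
  eval_nonneg_of_coeff_nonneg (coeff_pderiv_nonneg (coeff_pderiv_nonneg hf j) i) hw

theorem dotProduct_hessian_mulVec (f : MvPolynomial (Fin n) ℝ) (w x y : Fin n → ℝ) :
    x ⬝ᵥ hessian f w *ᵥ y = eval w (dirDeriv x (dirDeriv y f)) := by
  simp only [eval_dirDeriv, pderiv_dirDeriv, dotProduct, mulVec, hessian_apply]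
  refine Finset.sum_congr rfl fun i _ => ?_
  congr 1
  exact Finset.sum_congr rfl fun j _ => by rw [mul_comm, pderiv_comm]

theorem hessian_mulVec_self (hf : f.IsHomogeneous k) (w : Fin n → ℝ) (i : Fin n) :
    (hessian f w *ᵥ w) i = (k - 1 : ℕ) * eval w (pderiv i f) := by
  rw [← eval_dirDeriv_self hf.pderiv, eval_dirDeriv, mulVec, dotProduct]
  exact Finset.sum_congr rfl fun j _ => by rw [mul_comm, hessian_apply, pderiv_comm]

theorem dotProduct_hessian_mulVec_self (hf : f.IsHomogeneous k) (w x : Fin n → ℝ) :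
    x ⬝ᵥ hessian f w *ᵥ w = (k - 1 : ℕ) * eval w (dirDeriv x f) := by
  rw [eval_dirDeriv, dotProduct, Finset.mul_sum]
  exact Finset.sum_congr rfl fun i _ => by rw [hessian_mulVec_self hf]; ring

theorem eval_dirDeriv_dirDeriv_of_lt_two (hf : f.IsHomogeneous k) (hk : k < 2)
    (w x : Fin n → ℝ) : eval w (dirDeriv x (dirDeriv x f)) = 0 := by
  have h1 : (dirDeriv x f).IsHomogeneous 0 := by
    have := isHomogeneous_dirDeriv hf x
    rwa [Nat.sub_eq_zero_of_le (by omega)] at this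
  rw [eval_dirDeriv]
  exact Finset.sum_eq_zero fun i _ => by
    rw [pderiv_eq_zero_of_isHomogeneous_zero h1, map_zero, mul_zero]

/-- For homogeneous `f`, the reversed Cauchy–Schwarz inequality of the Hessian at `w` against `w`
is the second-order condition for log-concavity of `f`. -/
theorem mul_eval_dirDeriv_dirDeriv_le (hf : f.IsHomogeneous k)
    {w : Fin n → ℝ} (h : ReverseCauchySchwarz (hessian f w) w) (x : Fin n → ℝ) :
    eval w f * eval w (dirDeriv x (dirDeriv x f)) ≤ eval w (dirDeriv x f) ^ 2 := by
  have hx := h x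
  rw [dotProduct_hessian_mulVec, dotProduct_hessian_mulVec_self hf,
    dotProduct_hessian_mulVec_self hf, eval_dirDeriv_self hf] at hx
  set F := eval w f with hF
  set F₁ := eval w (dirDeriv x f)
  set F₂ := eval w (dirDeriv x (dirDeriv x f)) with hF₂
  rcases Nat.lt_or_ge k 2 with hk | hk
  · have : F₂ = 0 := eval_dirDeriv_dirDeriv_of_lt_two hf hk w x
    rw [this, mul_zero]; positivity
  · obtain ⟨d, rfl⟩ := Nat.exists_eq_add_of_le' hk
    push_cast [show d + 2 - 1 = d + 1 by omega] at hx
    have hd : (0 : ℝ) < d + 1 := by positivity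
    have h1 : (d + 2) * (F * F₂) ≤ (d + 1) * F₁ ^ 2 := by
      refine le_of_mul_le_mul_left ?_ hd
      nlinarith
    nlinarith [sq_nonneg F₁]

theorem reverseCauchySchwarz_hessian_of_mul_le (hf : f.IsHomogeneous k) {w : Fin n → ℝ}
    (hf0 : 0 < eval w f)
    (h : ∀ x, eval w f * eval w (dirDeriv x (dirDeriv x f)) ≤ eval w (dirDeriv x f) ^ 2) :
    ReverseCauchySchwarz (hessian f w) w := by
  have hww : w ⬝ᵥ hessian f w *ᵥ w = (k - 1 : ℕ) * (k * eval w f) := by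
    rw [dotProduct_hessian_mulVec_self hf, eval_dirDeriv_self hf]
  refine reverseCauchySchwarz_of_orthogonal (hessian_isSymm f w) (by rw [hww]; positivity)
    fun x hx => ?_
  rw [dotProduct_hessian_mulVec]
  rcases Nat.lt_or_ge k 2 with hk | hk
  · exact (eval_dirDeriv_dirDeriv_of_lt_two hf hk w x).le
  · have hk' : ((k - 1 : ℕ) : ℝ) ≠ 0 := by
      rw [Nat.cast_ne_zero]; omega
    rw [dotProduct_hessian_mulVec_self hf] at hx
    have hx := (mul_eq_zero.1 hx).resolve_left hk'
    have := h x
    rw [hx] at this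
    by_contra! hpos
    have := mul_pos hf0 hpos
    linarith

end NonnegCoeff

section LogConcave

open MvPolynomial Filter Topology

variable {n k : ℕ} {f g : MvPolynomial (Fin n) ℝ}

theorem hasDerivAt_eval_add_smul (f : MvPolynomial (Fin n) ℝ) (w a : Fin n → ℝ) (t : ℝ) :
    HasDerivAt (fun t : ℝ => eval (w + t • a) f) (eval (w + t • a) (dirDeriv a f)) t := by
  rw [eval_dirDeriv]
  induction f using MvPolynomial.induction_on with
  | C c => simpa using hasDerivAt_const t c
  | add p q hp hq =>
    simp only [map_add, mul_add, Finset.sum_add_distrib]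
    exact hp.add hq
  | mul_X p i hp =>
    have hX : HasDerivAt (fun t : ℝ => w i + t * a i) (a i) t := by
      simpa using ((hasDerivAt_id t).mul_const (a i)).const_add (w i)
    have h := hp.mul hX
    simp only [map_mul, eval_X, Pi.add_apply, Pi.smul_apply, smul_eq_mul]
    refine h.congr_deriv ?_
    simp only [pderiv_mul, pderiv_X, map_add, map_mul, eval_X, mul_add, Finset.sum_add_distrib,
      Pi.add_apply, Pi.smul_apply, smul_eq_mul, Finset.sum_mul]
    have : ∑ x, a x * ((eval (w + t • a)) p * eval (w + t • a) (Pi.single (M := fun _ => MvPolynomial (Fin n) ℝ) x 1 i)) =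
        eval (w + t • a) p * a i := by
      rw [Finset.sum_eq_single i]
      · simp [mul_comm]
      · intro j _ hj
        rw [Pi.single_eq_of_ne hj.symm]
        simp
      · simp
    rw [this]
    simp only [mul_assoc]

theorem LogConcaveOn.mul_le_sq {F : (Fin n → ℝ) → ℝ} (hF : LogConcaveOn F) {x y z : Fin n → ℝ}
    (hx : ∀ i, 0 ≤ x i) (hy : ∀ i, 0 ≤ y i) (hFx : 0 ≤ F x)
    (hz : ∀ i, z i = (x i + y i) / 2) : F x * F y ≤ F z ^ 2 := by
  have h := hF x y hx hy (1 / 2) (by norm_num) (by norm_num)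
  have hz' : (fun i => 1 / 2 * x i + (1 - 1 / 2) * y i) = z := by
    ext i; rw [hz]; ring
  rw [hz', show (1 - 1 / 2 : ℝ) = 1 / 2 by norm_num, ← Real.sqrt_eq_rpow, ← Real.sqrt_eq_rpow,
    ← Real.sqrt_mul hFx] at h
  exact (Real.sqrt_le_iff.1 h).2

/-- The second-order condition satisfied by log-concave polynomials at interior points. -/
theorem LogConcaveOn.mul_eval_dirDeriv_dirDeriv_le
    (hlc : LogConcaveOn fun x => eval x f) (hf : ∀ m, 0 ≤ f.coeff m) {w : Fin n → ℝ}
    (hw : ∀ i, 0 < w i) (a : Fin n → ℝ) :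
    eval w f * eval w (dirDeriv a (dirDeriv a f)) ≤ eval w (dirDeriv a f) ^ 2 := by
  by_contra! hlt
  set φ : ℝ → ℝ := fun t => eval (w + t • a) f with hφ
  set φ' : ℝ → ℝ := fun t => eval (w + t • a) (dirDeriv a f) with hφ'
  set φ'' : ℝ → ℝ := fun t => eval (w + t • a) (dirDeriv a (dirDeriv a f)) with hφ''
  have d1 : ∀ t, HasDerivAt φ (φ' t) t := hasDerivAt_eval_add_smul f w a
  have d2 : ∀ t, HasDerivAt φ' (φ'' t) t := hasDerivAt_eval_add_smul _ w a
  have d1n : ∀ t, HasDerivAt (fun t => φ (-t)) (-φ' (-t)) t := fun t =>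
    ((d1 (-t)).comp t (hasDerivAt_neg t)).congr_deriv (by ring)
  have d2n : ∀ t, HasDerivAt (fun t => φ' (-t)) (-φ'' (-t)) t := fun t =>
    ((d2 (-t)).comp t (hasDerivAt_neg t)).congr_deriv (by ring)
  set ψ : ℝ → ℝ := fun t => φ t * φ (-t) with hψ
  have e1 : ∀ t, HasDerivAt ψ (φ' t * φ (-t) + φ t * (-φ' (-t))) t := fun t =>
    (d1 t).mul (d1n t)
  have e1' : deriv ψ = fun t => φ' t * φ (-t) + φ t * (-φ' (-t)) := funext fun t => (e1 t).deriv
  have e2 : HasDerivAt (deriv ψ) (2 * (φ 0 * φ'' 0 - φ' 0 ^ 2)) 0 := by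
    rw [e1']
    refine (((d2 0).mul (d1n 0)).add ((d1 0).mul (d2n 0).neg)).congr_deriv ?_
    simp only [neg_zero, Pi.neg_apply]; ring
  have hpos : 0 < 2 * (φ 0 * φ'' 0 - φ' 0 ^ 2) := by
    have : eval w f * eval w (dirDeriv a (dirDeriv a f)) - eval w (dirDeriv a f) ^ 2 =
      φ 0 * φ'' 0 - φ' 0 ^ 2 := by simp [hφ, hφ', hφ'']
    rw [← this]; linarith
  have hmin : IsLocalMin ψ 0 := by
    refine isLocalMin_of_deriv_deriv_pos (by rw [e2.deriv]; exact hpos) ?_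
      (e1 0).continuousAt
    rw [e1']; simp only [neg_zero]; ring
  have hnear : ∀ᶠ t : ℝ in 𝓝 0, ∀ i, 0 ≤ (w + t • a) i ∧ 0 ≤ (w + (-t) • a) i := by
    rw [eventually_all]
    intro i
    have c1 : ContinuousAt (fun t : ℝ => (w + t • a) i) 0 := by
      simp only [Pi.add_apply, Pi.smul_apply]; fun_prop
    have c2 : ContinuousAt (fun t : ℝ => (w + (-t) • a) i) 0 := by
      simp only [Pi.add_apply, Pi.smul_apply]; fun_prop
    filter_upwards [c1.eventually (lt_mem_nhds (by simpa using hw i)),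
      c2.eventually (lt_mem_nhds (by simpa using hw i))] with t h1 h2
    exact ⟨h1.le, h2.le⟩
  have hconst : ψ =ᶠ[𝓝 0] fun _ => ψ 0 := by
    filter_upwards [hmin, hnear] with t h1 h2
    refine le_antisymm ?_ h1
    have hp := fun i => (h2 i).1
    have hm := fun i => (h2 i).2
    have := hlc.mul_le_sq (z := w) hp hm (eval_nonneg_of_coeff_nonneg hf hp)
      (fun i => by simp only [Pi.add_apply, Pi.smul_apply, smul_eq_mul]; ring)
    simpa [hψ, hφ, sq] using this
  have hzero : deriv (deriv ψ) 0 = 0 := by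
    have h := hconst.deriv.deriv_eq
    simpa using h
  rw [e2.deriv] at hzero
  exact hpos.ne' hzero

/-- A continuous nonnegative function satisfying the log-concavity inequality in the open orthant
is log-concave on the closed orthant. -/
theorem logConcaveOn_of_pos {F : (Fin n → ℝ) → ℝ} (hF : Continuous F)
    (h : ∀ x y : Fin n → ℝ, (∀ i, 0 < x i) → (∀ i, 0 < y i) → ∀ l : ℝ, 0 < l → l < 1 →
      F x ^ l * F y ^ (1 - l) ≤ F (fun i => l * x i + (1 - l) * y i)) :
    LogConcaveOn F := by
  intro x y hx hy l hl0 hl1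
  rcases hl0.eq_or_lt with rfl | hl0
  · simp
  rcases hl1.eq_or_lt with rfl | hl1
  · simp
  have hc : ∀ z : Fin n → ℝ,
      Tendsto (fun t : ℝ => F fun i => z i + t) (𝓝[>] 0) (𝓝 (F z)) := by
    intro z
    have : Continuous fun t : ℝ => F fun i => z i + t := by fun_prop
    simpa using (this.tendsto 0).mono_left nhdsWithin_le_nhds
  refine le_of_tendsto_of_tendsto
    (((hc x).rpow_const (Or.inr hl0.le)).mul ((hc y).rpow_const (Or.inr (by linarith))))
    (hc fun i => l * x i + (1 - l) * y i) ?_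
  filter_upwards [self_mem_nhdsWithin] with t ht
  have ht : 0 < t := ht
  have := h (fun i => x i + t) (fun i => y i + t) (fun i => by linarith [hx i])
    (fun i => by linarith [hy i]) l hl0 hl1
  refine this.trans (le_of_eq ?_)
  congr 1; ext i; ring

theorem LogConcaveOn.of_tendsto {α : Type*} {u : Filter α} [u.NeBot] {F : α → (Fin n → ℝ) → ℝ}
    {G : (Fin n → ℝ) → ℝ} (hF : ∀ᶠ a in u, LogConcaveOn (F a))
    (hG : ∀ x, (∀ i, 0 ≤ x i) → Tendsto (fun a => F a x) u (𝓝 (G x))) : LogConcaveOn G := by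
  intro x y hx hy l hl0 hl1
  have hl1' : 0 ≤ 1 - l := by linarith
  refine le_of_tendsto_of_tendsto
    (((hG x hx).rpow_const (Or.inr hl0)).mul ((hG y hy).rpow_const (Or.inr hl1')))
    (hG _ fun i => add_nonneg (mul_nonneg hl0 (hx i)) (mul_nonneg hl1' (hy i))) ?_
  filter_upwards [hF] with a ha using ha x y hx hy l hl0 hl1

theorem logConcaveOn_of_mul_eval_dirDeriv_dirDeriv_le (hf : ∀ m, 0 ≤ f.coeff m)
    (h : ∀ w : Fin n → ℝ, (∀ i, 0 < w i) → ∀ a,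
      eval w f * eval w (dirDeriv a (dirDeriv a f)) ≤ eval w (dirDeriv a f) ^ 2) :
    LogConcaveOn fun x => eval x f := by
  refine logConcaveOn_of_pos f.continuous_eval fun x y hx hy l hl0 hl1 => ?_
  rcases eq_or_ne f 0 with rfl | hf0
  · simp [Real.zero_rpow hl0.ne']
  set a := x - y with ha
  have hpt : ∀ t ∈ Set.Icc (0 : ℝ) 1, ∀ i, 0 < (y + t • a) i := by
    rintro t ⟨ht0, ht1⟩ i
    have : (y + t • a) i = t * x i + (1 - t) * y i := by simp [ha]; ring
    rw [this]
    rcases ht0.eq_or_lt with rfl | ht0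
    · simpa using hy i
    · exact add_pos_of_pos_of_nonneg (mul_pos ht0 (hx i)) (mul_nonneg (by linarith) (hy i).le)
  have hpos : ∀ t ∈ Set.Icc (0 : ℝ) 1, 0 < eval (y + t • a) f := fun t ht =>
    eval_pos_of_coeff_nonneg hf hf0 (hpt t ht)
  have d1 := hasDerivAt_eval_add_smul f y a
  have d2 := hasDerivAt_eval_add_smul (dirDeriv a f) y a
  have hsub : interior (Set.Icc (0 : ℝ) 1) ⊆ Set.Icc 0 1 := interior_subset
  have hconc : ConcaveOn ℝ (Set.Icc 0 1) fun t : ℝ => Real.log (eval (y + t • a) f) := by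
    refine concaveOn_of_hasDerivWithinAt2_nonpos (convex_Icc 0 1)
      (fun t ht => ((d1 t).log (hpos t ht).ne').continuousAt.continuousWithinAt)
      (fun t ht => ((d1 t).log (hpos t (hsub ht)).ne').hasDerivWithinAt)
      (fun t ht => ((d2 t).div (d1 t) (hpos t (hsub ht)).ne').hasDerivWithinAt)
      fun t ht => ?_
    refine div_nonpos_of_nonpos_of_nonneg ?_ (sq_nonneg _)
    have := h _ (hpt t (hsub ht)) a
    nlinarith
  have h1 := hpos 1 (by simp)
  have h0 := hpos 0 (by simp)
  have hl := hpos l ⟨hl0.le, hl1.le⟩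
  have key := hconc.2 (x := 1) (y := 0) (by simp) (by simp) hl0.le (by linarith : 0 ≤ 1 - l)
    (by ring)
  have hx1 : y + (1 : ℝ) • a = x := by simp [ha]
  have hy0 : y + (0 : ℝ) • a = y := by simp
  have hlz : y + l • a = fun i => l * x i + (1 - l) * y i := by
    ext i; simp [ha]; ring
  simp only [smul_eq_mul, mul_one, mul_zero, add_zero] at key
  rw [hx1] at h1 key
  rw [hy0] at h0 key
  rw [hlz] at hl key
  rw [Real.rpow_def_of_pos h1, Real.rpow_def_of_pos h0, ← Real.exp_add]
  rw [← Real.le_log_iff_exp_le hl]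
  linarith

theorem dirDeriv_single (i : Fin n) (f : MvPolynomial (Fin n) ℝ) :
    dirDeriv (Pi.single i 1) f = pderiv i f := by
  rw [dirDeriv, Finset.sum_eq_single i]
  · simp
  · intro j _ hj
    simp [Pi.single_eq_of_ne hj]
  · simp

theorem pderiv_pderiv_self_of_multiaffine (hmaf : ∀ m ∈ g.support, ∀ i, m i ≤ 1) (i : Fin n) :
    pderiv i (pderiv i g) = 0 := by
  ext m
  rw [coeff_pderiv, coeff_pderiv, coeff_zero, notMem_support_iff.1, zero_mul, zero_mul]
  intro hm
  have := hmaf _ hm i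
  simp at this

theorem multiaffine_pderiv (hmaf : ∀ m ∈ g.support, ∀ i, m i ≤ 1) (i : Fin n) :
    ∀ m ∈ (pderiv i g).support, ∀ j, m j ≤ 1 := by
  intro m hm j
  rw [mem_support_iff, coeff_pderiv] at hm
  exact (Nat.le_add_right _ _).trans (hmaf _ (mem_support_iff.2 (left_ne_zero_of_mul hm)) j)

theorem eval_add_smul_single_of_multiaffine (hmaf : ∀ m ∈ g.support, ∀ i, m i ≤ 1)
    (x : Fin n → ℝ) (i : Fin n) (t : ℝ) :
    eval (x + t • Pi.single i 1) g = eval x g + t * eval x (pderiv i g) := by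
  have d1 := hasDerivAt_eval_add_smul g x (Pi.single i 1)
  have d2 := hasDerivAt_eval_add_smul (pderiv i g) x (Pi.single i 1)
  simp only [dirDeriv_single, pderiv_pderiv_self_of_multiaffine hmaf, map_zero] at d1 d2
  have hc : ∀ t : ℝ, eval (x + t • Pi.single i 1) (pderiv i g) = eval x (pderiv i g) := fun t => by
    simpa using is_const_of_deriv_eq_zero (fun t => (d2 t).differentiableAt)
      (fun t => (d2 t).deriv) t 0
  have d3 : ∀ t : ℝ, HasDerivAt (fun t : ℝ => eval (x + t • Pi.single i 1) g -
      t * eval x (pderiv i g)) 0 t := fun t =>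
    ((d1 t).sub ((hasDerivAt_id t).mul_const _)).congr_deriv (by rw [hc]; ring)
  have := is_const_of_deriv_eq_zero (fun t => (d3 t).differentiableAt) (fun t => (d3 t).deriv) t 0
  simp only [zero_smul, add_zero, zero_mul, sub_zero] at this
  linarith

theorem LogConcaveOn.const_mul_comp_add {F : (Fin n → ℝ) → ℝ} (hF : LogConcaveOn F)
    (hF0 : ∀ x, (∀ i, 0 ≤ x i) → 0 ≤ F x) {c : ℝ} (hc : 0 < c) {u : Fin n → ℝ}
    (hu : ∀ i, 0 ≤ u i) : LogConcaveOn fun x => c * F (x + u) := by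
  intro x y hx hy l hl0 hl1
  have hxu : ∀ i, 0 ≤ (x + u) i := fun i => add_nonneg (hx i) (hu i)
  have hyu : ∀ i, 0 ≤ (y + u) i := fun i => add_nonneg (hy i) (hu i)
  have h := hF (x + u) (y + u) hxu hyu l hl0 hl1
  have hz : (fun i => l * (x + u) i + (1 - l) * (y + u) i) =
      (fun i => l * x i + (1 - l) * y i) + u := by
    ext i; simp only [Pi.add_apply]; ring
  rw [hz] at h
  have hcl : c ^ l * c ^ (1 - l) = c := by
    rw [← Real.rpow_add hc]; simp
  calc (c * F (x + u)) ^ l * (c * F (y + u)) ^ (1 - l)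
      = (c ^ l * c ^ (1 - l)) * (F (x + u) ^ l * F (y + u) ^ (1 - l)) := by
        rw [Real.mul_rpow hc.le (hF0 _ hxu), Real.mul_rpow hc.le (hF0 _ hyu)]; ring
    _ ≤ _ := by rw [hcl]; exact mul_le_mul_of_nonneg_left h hc.le

/-- Partial derivatives of multiaffine log-concave polynomials are log-concave: `∂ᵢ g` is the limit
of `t⁻¹ g(x + t eᵢ)` as `t → ∞`. -/
theorem LogConcaveOn.pderiv_of_multiaffine (hlc : LogConcaveOn fun x => eval x g)
    (hmaf : ∀ m ∈ g.support, ∀ i, m i ≤ 1) (hg : ∀ m, 0 ≤ g.coeff m) (i : Fin n) :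
    LogConcaveOn fun x => eval x (pderiv i g) := by
  refine LogConcaveOn.of_tendsto (u := atTop)
    (F := fun (t : ℝ) x => t⁻¹ * eval (x + t • Pi.single i 1) g) ?_ fun x hx => ?_
  · filter_upwards [eventually_gt_atTop 0] with t ht
    refine hlc.const_mul_comp_add (fun x hx => eval_nonneg_of_coeff_nonneg hg hx)
      (inv_pos.2 ht) fun j => ?_
    rw [Pi.smul_apply, Pi.single_apply]
    split_ifs <;> simp [ht.le]
  · have h : Tendsto (fun t : ℝ => t⁻¹ * eval x g + eval x (pderiv i g)) atTop
        (𝓝 (eval x (pderiv i g))) := by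
      simpa using (tendsto_inv_atTop_zero.mul_const (eval x g)).add_const (eval x (pderiv i g))
    refine h.congr' ?_
    filter_upwards [eventually_gt_atTop 0] with t ht
    rw [eval_add_smul_single_of_multiaffine hmaf]
    field_simp

/-- Log-concavity is the reversed Cauchy–Schwarz inequality for all Hessians in the open orthant. -/
theorem logConcaveOn_iff_reverseCauchySchwarz_hessian (hhom : f.IsHomogeneous k)
    (hf : ∀ m, 0 ≤ f.coeff m) :
    (LogConcaveOn fun x => eval x f) ↔
      ∀ w : Fin n → ℝ, (∀ i, 0 < w i) → ReverseCauchySchwarz (hessian f w) w := by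
  refine ⟨fun h w hw => ?_, fun h => ?_⟩
  · rcases eq_or_ne f 0 with rfl | hf0
    · intro x
      simp only [dotProduct_hessian_mulVec, dirDeriv_zero, map_zero]
      norm_num
    · exact reverseCauchySchwarz_hessian_of_mul_le hhom (eval_pos_of_coeff_nonneg hf hf0 hw)
        (h.mul_eval_dirDeriv_dirDeriv_le hf hw)
  · exact logConcaveOn_of_mul_eval_dirDeriv_dirDeriv_le hf fun w hw =>
      mul_eval_dirDeriv_dirDeriv_le hhom (h w hw)

theorem reverseCauchySchwarz_hessian_of_lt_two (hhom : f.IsHomogeneous k) (hk : k < 2)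
    (w : Fin n → ℝ) : ReverseCauchySchwarz (hessian f w) w := by
  intro x
  rw [dotProduct_hessian_mulVec f w x x, eval_dirDeriv_dirDeriv_of_lt_two hhom hk, zero_mul]
  positivity

theorem eval_eq_of_isHomogeneous_zero (hf : f.IsHomogeneous 0) (v w : Fin n → ℝ) :
    eval v f = eval w f := by
  rw [totalDegree_eq_zero_iff_eq_C.1 (Nat.le_zero.1 hf.totalDegree_le), eval_C, eval_C]

/-- The Hessian of the quadratic form `∂_v f`, where `f` is cubic, is the Hessian of `f` at `v`. -/
theorem hessian_dirDeriv_of_cubic (hhom : f.IsHomogeneous 3) (v w : Fin n → ℝ) :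
    hessian (dirDeriv v f) w = hessian f v := by
  ext i j
  have h1 : (pderiv i (pderiv j f)).IsHomogeneous 1 := hhom.pderiv.pderiv
  rw [hessian_apply, hessian_apply, pderiv_dirDeriv, pderiv_dirDeriv,
    eval_eq_of_isHomogeneous_zero (isHomogeneous_dirDeriv h1 v) w v, eval_dirDeriv_self h1]
  simp

open Matrix in
theorem ReverseCauchySchwarz.change_of_nonneg {ι : Type*} [Fintype ι] {A : Matrix ι ι ℝ}
    (hA : A.IsSymm) (hA0 : ∀ i j, 0 ≤ A i j) {v w : ι → ℝ} (hv : ∀ i, 0 < v i)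
    (hw : ∀ i, 0 < w i) (h : ReverseCauchySchwarz A v) : ReverseCauchySchwarz A w := by
  have hnonneg : ∀ {u : ι → ℝ}, (∀ i, 0 < u i) → ∀ i j, 0 ≤ u i * (A i j * u j) :=
    fun hu i j => mul_nonneg (hu i).le (mul_nonneg (hA0 i j) (hu j).le)
  have hsum : ∀ u : ι → ℝ, u ⬝ᵥ A *ᵥ u = ∑ i, ∑ j, u i * (A i j * u j) := fun u => by
    simp only [dotProduct, mulVec, Finset.mul_sum]
  have hquad : ∀ {u : ι → ℝ}, (∀ i, 0 < u i) → 0 ≤ u ⬝ᵥ A *ᵥ u := fun hu => by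
    rw [hsum]
    exact Finset.sum_nonneg fun i _ => Finset.sum_nonneg fun j _ => hnonneg hu i j
  rcases (hquad hv).eq_or_lt with h0 | h0
  · have hA_zero : A = 0 := by
      ext i j
      rw [hsum, eq_comm, Finset.sum_eq_zero_iff_of_nonneg
        fun i _ => Finset.sum_nonneg fun j _ => hnonneg hv i j] at h0
      have := (Finset.sum_eq_zero_iff_of_nonneg fun j _ => hnonneg hv i j).1
        (h0 i (Finset.mem_univ _)) j (Finset.mem_univ _)
      have := (mul_eq_zero.1 this).resolve_left (hv i).ne'
      exact (mul_eq_zero.1 this).resolve_right (hv j).ne'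
    intro x
    simp [hA_zero]
  · exact h.change hA h0 (hquad hw)

open Matrix in
/-- A local-to-global principle: the reversed Cauchy–Schwarz inequality for the Hessian of `∂_v f`
follows from that for the Hessians of its partial derivatives. The inequality for `f` itself
guarantees that the Hessian of `∂_v f` is irreducible. -/
theorem reverseCauchySchwarz_hessian_dirDeriv (hhom : f.IsHomogeneous k) (hk : 4 ≤ k)
    (hf : ∀ m, 0 ≤ f.coeff m) {v w : Fin n → ℝ} (hv : ∀ i, 0 < v i) (hw : ∀ i, 0 < w i)
    (hfw : ReverseCauchySchwarz (hessian f w) w)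
    (hslice : ∀ i, ReverseCauchySchwarz (hessian (pderiv i (dirDeriv v f)) w) w) :
    ReverseCauchySchwarz (hessian (dirDeriv v f) w) w := by
  have hw0 : ∀ i, 0 ≤ w i := fun i => (hw i).le
  set h := dirDeriv v f with hh
  have hh0 : ∀ m, 0 ≤ h.coeff m := coeff_dirDeriv_nonneg hf fun i => (hv i).le
  have hhh : h.IsHomogeneous (k - 1) := isHomogeneous_dirDeriv hhom v
  set c : ℝ := ((k - 1 - 1 - 1 : ℕ) : ℝ) with hc
  have hc0 : 0 < c := by rw [hc, Nat.cast_pos]; omega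
  have hkey : ReverseCauchySchwarz (c • hessian h w) w := by
    refine ReverseCauchySchwarz.of_slices (Q := fun i => hessian (pderiv i h) w)
      ((hessian_isSymm h w).smul c) (fun i j => mul_nonneg hc0.le (hessian_nonneg hh0 hw0 i j)) hw
      (fun i => hessian_nonneg (coeff_pderiv_nonneg hh0 i) hw0) (fun i => ?_) ?_ hslice ?_
    · ext j
      rw [hessian_mulVec_self hhh.pderiv, pderiv_comm]
      rfl
    · ext i j
      have := eval_dirDeriv_self ((hhh.pderiv (i := j)).pderiv (i := i)) w
      rw [eval_dirDeriv] at this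
      rw [Matrix.smul_apply, hessian_apply, smul_eq_mul, ← this, Matrix.sum_apply]
      refine Finset.sum_congr rfl fun l _ => ?_
      rw [Matrix.smul_apply, hessian_apply, smul_eq_mul, pderiv_comm j l, pderiv_comm i l]
    · intro u hu i j hi hj
      refine eq_of_reverseCauchySchwarz_of_constant_on_edges (hessian_nonneg hf hw0) hw hfw
        (c := u) (fun i j hij => hu i j ?_) ?_ ?_
      · have hne : pderiv i (pderiv j f) ≠ 0 := by
          intro h0
          rw [hessian_apply, h0, map_zero] at hij
          exact hij rfl
        have hcoeff := coeff_pderiv_nonneg (coeff_pderiv_nonneg hf j) i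
        have hne' := dirDeriv_ne_zero hcoeff hne hhom.pderiv.pderiv (by omega) hv
        have := eval_pos_of_coeff_nonneg (coeff_dirDeriv_nonneg hcoeff fun i => (hv i).le) hne' hw
        rw [Matrix.smul_apply, hessian_apply, hh, pderiv_dirDeriv, pderiv_dirDeriv, smul_eq_mul]
        exact (mul_pos hc0 this).ne'
      all_goals
        have hrow : ∀ i, ((c • hessian h w) *ᵥ w) i ≠ 0 → (hessian f w *ᵥ w) i ≠ 0 := by
          intro i hi h0
          rw [hessian_mulVec_self hhom, mul_eq_zero, Nat.cast_eq_zero] at h0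
          have hz : pderiv i f = 0 := by
            by_contra hne
            exact (eval_pos_of_coeff_nonneg (coeff_pderiv_nonneg hf i) hne hw).ne'
              (h0.resolve_left (by omega))
          apply hi
          rw [smul_mulVec, Pi.smul_apply, hessian_mulVec_self hhh, hh, pderiv_dirDeriv, hz,
            dirDeriv_zero]
          simp
        exact hrow _ ‹_›
  intro x
  have := hkey x
  simp only [smul_mulVec, dotProduct_smul, smul_eq_mul] at this
  refine le_of_mul_le_mul_left ?_ (mul_pos hc0 hc0)
  linarith

theorem reverseCauchySchwarz_hessian_foldr (hmaf : ∀ m ∈ g.support, ∀ i, m i ≤ 1)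
    (hhom : g.IsHomogeneous k) (hg : ∀ m, 0 ≤ g.coeff m) (hlc : LogConcaveOn fun x => eval x g)
    {vs : List (Fin n → ℝ)} (hvs : ∀ v ∈ vs, ∀ i, 0 < v i) {w : Fin n → ℝ} (hw : ∀ i, 0 < w i) :
    ReverseCauchySchwarz (hessian (vs.foldr dirDeriv g) w) w := by
  induction k generalizing g vs w with
  | zero =>
    have := isHomogeneous_foldr_dirDeriv hhom vs
    exact reverseCauchySchwarz_hessian_of_lt_two this (by omega) w
  | succ k ihk =>
    induction vs generalizing w with
    | nil => exact (logConcaveOn_iff_reverseCauchySchwarz_hessian hhom hg).1 hlc w hw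
    | cons v vs ih =>
      have hv := hvs v List.mem_cons_self
      have hvs' : ∀ u ∈ vs, ∀ i, 0 < u i := fun u hu => hvs u (List.mem_cons_of_mem v hu)
      have hf := isHomogeneous_foldr_dirDeriv hhom vs
      have hf0 := coeff_foldr_dirDeriv_nonneg hg fun u hu i => (hvs' u hu i).le
      rw [List.foldr_cons]
      rcases lt_trichotomy (k + 1 - vs.length) 3 with hlt | heq | hgt
      · exact reverseCauchySchwarz_hessian_of_lt_two (isHomogeneous_dirDeriv hf v) (by omega) w
      · rw [heq] at hf
        rw [hessian_dirDeriv_of_cubic hf]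
        exact (ih hvs' hv).change_of_nonneg (hessian_isSymm _ v)
          (hessian_nonneg hf0 fun i => (hv i).le) hv hw
      · refine reverseCauchySchwarz_hessian_dirDeriv hf hgt hf0 hv hw (ih hvs' hw) fun i => ?_
        rw [← List.foldr_cons (f := dirDeriv), pderiv_foldr_dirDeriv]
        exact ihk (multiaffine_pderiv hmaf i) hhom.pderiv (coeff_pderiv_nonneg hg i)
          (hlc.pderiv_of_multiaffine hmaf hg i) hvs hw

theorem continuous_eval_foldr_dirDeriv_add (vs : List (Fin n → ℝ)) (g : MvPolynomial (Fin n) ℝ)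
    (x : Fin n → ℝ) :
    Continuous fun t : ℝ => eval x ((vs.map fun v i => v i + t).foldr dirDeriv g) := by
  induction vs generalizing g with
  | nil => exact continuous_const (y := eval x g)
  | cons v vs ih =>
    simp only [List.map_cons, List.foldr_cons, eval_dirDeriv, pderiv_foldr_dirDeriv]
    exact continuous_finsetSum _ fun i _ => ((continuous_const_add (v i)).mul (ih (pderiv i g)))

end LogConcave

/-- **Complete log-concavity of multiaffine homogeneous log-concave polynomials:**
if `g` is multiaffine, homogeneous, has nonnegative coefficients and is log-concave on the
nonnegative orthant, then any iterated directional derivative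
`∂_{v₁} ⋯ ∂_{v_m} g` along nonnegative directions is log-concave on the nonnegative orthant. -/
theorem log_concave_directional_derivatives {n k : ℕ} (g : MvPolynomial (Fin n) ℝ)
    (hmaf : ∀ m ∈ g.support, ∀ i, m i ≤ 1)
    (hhom : g.IsHomogeneous k)
    (hcoeff : ∀ m, 0 ≤ g.coeff m)
    (hlc : LogConcaveOn (fun x => MvPolynomial.eval x g)) :
    ∀ vs : List (Fin n → ℝ), (∀ v ∈ vs, ∀ i, 0 ≤ v i) →
      LogConcaveOn (fun x => MvPolynomial.eval x (vs.foldr dirDeriv g)) := by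
  intro vs hvs
  refine LogConcaveOn.of_tendsto (u := nhdsWithin (0 : ℝ) (Set.Ioi 0))
    (F := fun t x => MvPolynomial.eval x ((vs.map fun v i => v i + t).foldr dirDeriv g)) ?_
    fun x _ => ?_
  · filter_upwards [self_mem_nhdsWithin] with t ht
    have hpos : ∀ v ∈ vs.map fun v i => v i + t, ∀ i, 0 < v i := by
      simp only [List.mem_map]
      rintro _ ⟨v, hv, rfl⟩ i
      exact add_pos_of_nonneg_of_pos (hvs v hv i) ht
    exact (logConcaveOn_iff_reverseCauchySchwarz_hessian (isHomogeneous_foldr_dirDeriv hhom _)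
      (coeff_foldr_dirDeriv_nonneg hcoeff fun v hv i => (hpos v hv i).le)).2 fun w hw =>
        reverseCauchySchwarz_hessian_foldr hmaf hhom hcoeff hlc hpos hw
  · simpa using ((continuous_eval_foldr_dirDeriv_add vs g x).tendsto 0).mono_left
      nhdsWithin_le_nhds
end

section
/- Let μ : 𝒞(n,k) → ℝ≥0 satisfy the α-approximate exchange property for some α ≥ 0. Then for every S ∈ 𝒞(n,k), every i ∈ S, and every subset F ⊆ S∖{i}: μ(S)·(∑_{T∈𝒞(n,k), T⊇F} μ(T)) ≤ α·(∑_{V∈𝒞(n,k), V⊇S∖{i}} μ(V))·(∑_{U∈𝒞(n,k), U⊇F∪{i}} μ(U)). -/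
open Finset

/-- `μ` satisfies the `α`-approximate exchange property on `k`-element subsets of `{1,…,n}`. -/
def ApproxExchange (n k : ℕ) (α : ℝ) (μ : Finset (Fin n) → ℝ) : Prop :=
  ∀ S T : Finset (Fin n), S.card = k → T.card = k → ∀ i ∈ S, ∃ j ∈ T,
    ((S \ {i}) ∪ {j}).card = k ∧ ((T \ {j}) ∪ {i}).card = k ∧
    μ S * μ T ≤ α * (μ ((S \ {i}) ∪ {j}) * μ ((T \ {j}) ∪ {i}))

theorem notMem_of_card_sdiff_union {β : Type*} [DecidableEq β] {A : Finset β} {a b : β}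
    (ha : a ∈ A) (h : ((A \ {a}) ∪ {b}).card = A.card) : b ∉ A \ {a} := by
  intro hb
  rw [union_eq_left.2 (singleton_subset_iff.2 hb), sdiff_singleton_eq_erase] at h
  exact (card_erase_lt_of_mem ha).ne h

/-- **Injection step in the mixing analysis:** if `μ` satisfies `α`-approximate exchange,
then for every `k`-set `S`, every `i ∈ S`, and every `F ⊆ S ∖ {i}`,
`μ(S)·∑_{T ⊇ F} μ(T) ≤ α·(∑_{V ⊇ S∖{i}} μ(V))·(∑_{U ⊇ F∪{i}} μ(U))`. -/
theorem exchange_implies_sum_inequality (n k : ℕ) (hk1 : 1 ≤ k) (hkn : k ≤ n)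
    (α : ℝ) (hα : 0 ≤ α)
    (μ : Finset (Fin n) → ℝ) (hnn : ∀ S : Finset (Fin n), S.card = k → 0 ≤ μ S)
    (hex : ApproxExchange n k α μ)
    (S : Finset (Fin n)) (hS : S.card = k) (i : Fin n) (hi : i ∈ S)
    (F : Finset (Fin n)) (hF : F ⊆ S \ {i}) :
    μ S * ∑ T ∈ (Finset.powersetCard k (Finset.univ : Finset (Fin n))).filter
        (fun T => F ⊆ T), μ T ≤
      α * ((∑ V ∈ (Finset.powersetCard k (Finset.univ : Finset (Fin n))).filter
              (fun V => S \ {i} ⊆ V), μ V) *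
           (∑ U ∈ (Finset.powersetCard k (Finset.univ : Finset (Fin n))).filter
              (fun U => insert i F ⊆ U), μ U)) := by
  have hex' : ∀ T : Finset (Fin n), T.card = k → ∃ j ∈ T, j ∉ S \ {i} ∧ i ∉ T \ {j} ∧
      ((S \ {i}) ∪ {j}).card = k ∧ ((T \ {j}) ∪ {i}).card = k ∧
      μ S * μ T ≤ α * (μ ((S \ {i}) ∪ {j}) * μ ((T \ {j}) ∪ {i})) := by
    intro T hT
    obtain ⟨j, hj, hV, hU, hle⟩ := hex S T hS hT i hi
    exact ⟨j, hj, notMem_of_card_sdiff_union hi (hV.trans hS.symm),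
      notMem_of_card_sdiff_union hj (hU.trans hT.symm), hV, hU, hle⟩
  have : Nonempty (Fin n) := ⟨i⟩
  choose! j hjT hjS hiT hV hU hle using hex'
  set e : Finset (Fin n) → Finset (Fin n) × Finset (Fin n) :=
    fun T => ((S \ {i}) ∪ {j T}, (T \ {j T}) ∪ {i}) with he
  rw [sum_mul_sum, ← sum_product', mul_sum, mul_sum]
  have hinj : Set.InjOn e ((powersetCard k (univ : Finset (Fin n))).filter (F ⊆ ·)) := by
    intro T hT T' hT' h
    simp only [coe_filter, mem_powersetCard_univ, Set.mem_ofPred_eq] at hT hT'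
    simp only [he, Prod.mk.injEq] at h
    have hj : j T = j T' := by
      have hmem : j T ∈ (S \ {i}) ∪ {j T'} := by rw [← h.1]; simp
      simpa [hjS T hT.1] using (mem_union.1 hmem).resolve_left (hjS T hT.1)
    have hT_eq : ∀ T, T.card = k → ((T \ {j T}) ∪ {i}) \ {i} ∪ {j T} = T := by
      intro T hT
      rw [union_sdiff_cancel_right (disjoint_singleton_right.2 (hiT T hT))]
      exact sdiff_union_of_subset (singleton_subset_iff.2 (hjT T hT))
    rw [← hT_eq T hT.1, ← hT_eq T' hT'.1, h.2, hj]
  calc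
    _ ≤ ∑ T ∈ (powersetCard k (univ : Finset (Fin n))).filter (F ⊆ ·),
          α * (μ (e T).1 * μ (e T).2) :=
      sum_le_sum fun T hT => hle T (by simpa using (mem_filter.1 hT).1)
    _ = ∑ p ∈ ((powersetCard k (univ : Finset (Fin n))).filter (F ⊆ ·)).image e,
          α * (μ p.1 * μ p.2) := (sum_image (f := fun p => α * (μ p.1 * μ p.2)) hinj).symm
    _ ≤ _ := by
      refine sum_le_sum_of_subset_of_nonneg ?_ ?_
      · intro p hp
        obtain ⟨T, hT, rfl⟩ := mem_image.1 hp
        simp only [mem_filter, mem_powersetCard_univ] at hT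
        simp only [mem_product, mem_filter, mem_powersetCard_univ, he]
        refine ⟨⟨hV T hT.1, subset_union_left⟩, hU T hT.1, insert_subset (by simp) ?_⟩
        intro x hx
        have hxj : x ≠ j T := fun h => hjS T hT.1 (h ▸ hF hx)
        simp [hT.2 hx, hxj]
      · intro p hp _
        simp only [mem_product, mem_filter, mem_powersetCard_univ] at hp
        exact mul_nonneg hα (mul_nonneg (hnn _ hp.1.1) (hnn _ hp.2.1))
end

section
/- Let ν and π_μ be probability distributions on 𝒞(n,k), where μ : 𝒞(n,k) → ℝ≥0 is not identically zero, has a log-concave generating polynomial, π_μ(S) = μ(S)/∑_{S'}μ(S'), and ν is absolutely continuous with respect to π_μ (ν(S) = 0 whenever μ(S) = 0). Let P be the down-up walk for μ. Then the Kullback–Leibler divergence contracts: D(νP ‖ π_μ) ≤ (1 − 1/k)·D(ν ‖ π_μ), where (νP)(S') = ∑_S ν(S)·P(S,S'). -/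
open Finset

/-- Generating polynomial `g_μ(x) = ∑_{S ∈ 𝒞(n,k)} μ(S) ∏_{i∈S} x_i`. -/
noncomputable def genPoly (n k : ℕ) (μ : Finset (Fin n) → ℝ) (x : Fin n → ℝ) : ℝ :=
  ∑ S ∈ Finset.powersetCard k (Finset.univ : Finset (Fin n)), μ S * ∏ i ∈ S, x i

/-- The down-up walk transition kernel for `μ` on `k`-element subsets of `ground`. -/
noncomputable def downUp {α : Type*} [DecidableEq α] (ground : Finset α) (k : ℕ)
    (μ : Finset α → ℝ) (S S' : Finset α) : ℝ :=
  if μ S = 0 then (if S' = S then 1 else 0)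
  else (1 / (k : ℝ)) * ∑ e ∈ S,
    (if S \ {e} ⊆ S' then
      μ S' / ∑ S'' ∈ (ground.powersetCard k).filter (fun S'' => S \ {e} ⊆ S''), μ S''
    else 0)

/-- The normalized stationary distribution `π_μ(S) = μ(S) / ∑_{S'} μ(S')`. -/
noncomputable def statDist {α : Type*} [DecidableEq α] (ground : Finset α) (k : ℕ)
    (μ : Finset α → ℝ) (S : Finset α) : ℝ :=
  μ S / ∑ S' ∈ ground.powersetCard k, μ S'

/-- Kullback–Leibler divergence `D(ν ‖ π) = ∑_{S : ν(S) > 0} ν(S) log(ν(S)/π(S))` over the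
`k`-element subsets of `ground`. -/
noncomputable def klDiv {α : Type*} [DecidableEq α] (ground : Finset α) (k : ℕ)
    (ν π : Finset α → ℝ) : ℝ :=
  ∑ S ∈ ground.powersetCard k, if 0 < ν S then ν S * Real.log (ν S / π S) else 0

section Combinatorics

variable {α : Type*} [DecidableEq α]

/-- The section of `f` at `i`: `T ↦ f (T ∪ {i})` on sets avoiding `i`. -/
def link (i : α) (f : Finset α → ℝ) (T : Finset α) : ℝ :=
  if i ∈ T then 0 else f (insert i T)

variable [Fintype α]

/-- Total weight of the `k`-element supersets of `T`. -/
def upSum (k : ℕ) (f : Finset α → ℝ) (T : Finset α) : ℝ :=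
  ∑ S ∈ ((univ : Finset α).powersetCard k).filter (fun S => T ⊆ S), f S

/-- The relative entropy of two weight functions on `k`-element sets, without normalization. -/
noncomputable def relEnt (k : ℕ) (f g : Finset α → ℝ) : ℝ :=
  ∑ S ∈ (univ : Finset α).powersetCard k, f S * Real.log (f S / g S)

lemma sum_link (i : α) (m : ℕ) (f : Finset α → ℝ) :
    ∑ T ∈ (univ : Finset α).powersetCard m, link i f T =
      ∑ S ∈ (univ : Finset α).powersetCard (m + 1), if i ∈ S then f S else 0 := by
  have h : ∀ T : Finset α, link i f T = if i ∉ T then f (insert i T) else 0 := by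
    intro T
    by_cases hi : i ∈ T <;> simp [link, hi]
  simp only [h]
  rw [← sum_filter, ← sum_filter]
  refine sum_nbij' (insert i) (fun S => S.erase i) ?_ ?_ ?_ ?_ ?_
  · intro T hT
    simp only [mem_filter, mem_powersetCard_univ] at hT ⊢
    simp [card_insert_of_notMem hT.2, hT.1]
  · intro S hS
    simp only [mem_filter, mem_powersetCard_univ] at hS ⊢
    simp [card_erase_of_mem hS.2, hS.1]
  · intro T hT
    exact erase_insert (mem_filter.1 hT).2
  · intro S hS
    exact insert_erase (mem_filter.1 hS).2
  · intro T _
    rfl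

lemma sum_sum_mem (k : ℕ) (F : α → Finset α → ℝ) :
    ∑ i, ∑ S ∈ (univ : Finset α).powersetCard k, (if i ∈ S then F i S else 0) =
      ∑ S ∈ (univ : Finset α).powersetCard k, ∑ i ∈ S, F i S := by
  rw [sum_comm]
  refine sum_congr rfl fun S _ => ?_
  rw [← sum_filter]
  simp

lemma sum_sum_link (m : ℕ) (f : Finset α → ℝ) :
    ∑ i, ∑ T ∈ (univ : Finset α).powersetCard m, link i f T =
      (m + 1) * ∑ S ∈ (univ : Finset α).powersetCard (m + 1), f S := by
  simp only [sum_link]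
  rw [sum_sum_mem (m + 1) fun _ S => f S, mul_sum]
  refine sum_congr rfl fun S hS => ?_
  rw [sum_const, (mem_powersetCard_univ.1 hS), nsmul_eq_mul]
  push_cast
  ring

lemma relEnt_link (i : α) (m : ℕ) (f g : Finset α → ℝ) :
    relEnt m (link i f) (link i g) =
      ∑ T ∈ (univ : Finset α).powersetCard m,
        link i (fun S => f S * Real.log (f S / g S)) T := by
  refine sum_congr rfl fun T _ => ?_
  by_cases hi : i ∈ T <;> simp [link, hi]

lemma sum_relEnt_link (m : ℕ) (f g : Finset α → ℝ) :
    ∑ i, relEnt m (link i f) (link i g) = (m + 1) * relEnt (m + 1) f g := by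
  simp only [relEnt_link, sum_sum_link]
  rfl

lemma upSum_link (i : α) (m : ℕ) (f : Finset α → ℝ) :
    upSum m (link i f) = link i (upSum (m + 1) f) := by
  funext T
  by_cases hi : i ∈ T
  · rw [link, if_pos hi]
    refine sum_eq_zero fun S hS => ?_
    simp [link, (mem_filter.1 hS).2 hi]
  · rw [link, if_neg hi, upSum, upSum, sum_filter, sum_filter]
    have h := sum_link i m fun S => if insert i T ⊆ S then f S else 0
    rw [show (∑ S ∈ (univ : Finset α).powersetCard (m + 1),
        if insert i T ⊆ S then f S else 0) = ∑ S ∈ (univ : Finset α).powersetCard (m + 1),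
          if i ∈ S then (if insert i T ⊆ S then f S else 0) else 0 from ?_, ← h]
    · refine sum_congr rfl fun S _ => ?_
      by_cases hS : i ∈ S
      · simp [link, hS]
      · simp [link, hS, insert_subset_insert_iff hi]
    · refine sum_congr rfl fun S _ => ?_
      by_cases hS : i ∈ S <;> simp [hS, insert_subset_iff]

lemma sum_erase_eq_sum_subset {m : ℕ} {S : Finset α} (hS : S.card = m + 1)
    (φ : Finset α → ℝ) :
    ∑ e ∈ S, φ (S \ {e}) =
      ∑ T ∈ (univ : Finset α).powersetCard m, if T ⊆ S then φ T else 0 := by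
  rw [← sum_filter]
  refine sum_nbij (fun e => S \ {e}) ?_ ?_ ?_ fun _ _ => rfl
  · intro e he
    simp only [mem_filter, mem_powersetCard_univ]
    refine ⟨?_, sdiff_subset⟩
    rw [sdiff_singleton_eq_erase, card_erase_of_mem he, hS]
    rfl
  · intro a ha b _ hab
    by_contra hne
    have : a ∈ S \ {b} := by simp [hne, mem_coe.1 ha]
    rw [← show S \ {a} = S \ {b} from hab] at this
    simp at this
  · intro T hT
    simp only [coe_filter, mem_powersetCard_univ, Set.mem_ofPred_eq] at hT
    obtain ⟨e, he⟩ := card_eq_one.1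
      (show (S \ T).card = 1 by rw [card_sdiff_of_subset hT.2, hS, hT.1]; simp)
    have heS : e ∈ S \ T := by simp [he]
    refine ⟨e, by simpa using (mem_sdiff.1 heS).1, ?_⟩
    change S \ {e} = T
    rw [← he, Finset.sdiff_sdiff_eq_self hT.2]

lemma sum_mul_sum_erase (m : ℕ) (f φ : Finset α → ℝ) :
    ∑ S ∈ (univ : Finset α).powersetCard (m + 1), f S * ∑ e ∈ S, φ (S \ {e}) =
      ∑ T ∈ (univ : Finset α).powersetCard m, upSum (m + 1) f T * φ T := by
  simp only [upSum, sum_filter, sum_mul, ite_mul, zero_mul]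
  rw [sum_comm]
  refine sum_congr rfl fun S hS => ?_
  rw [sum_erase_eq_sum_subset (mem_powersetCard_univ.1 hS), mul_sum]
  simp only [mul_ite, mul_zero]

lemma upSum_nonneg {k : ℕ} {f : Finset α → ℝ} (hf : ∀ S : Finset α, S.card = k → 0 ≤ f S)
    (T : Finset α) : 0 ≤ upSum k f T :=
  sum_nonneg fun S hS => hf S (mem_powersetCard_univ.1 (mem_filter.1 hS).1)

lemma upSum_eq_zero {k : ℕ} {f g : Finset α → ℝ}
    (hg : ∀ S : Finset α, S.card = k → 0 ≤ g S)
    (hfg : ∀ S : Finset α, S.card = k → g S = 0 → f S = 0) {T : Finset α}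
    (h : upSum k g T = 0) : upSum k f T = 0 := by
  refine sum_eq_zero fun S hS => ?_
  have hc := mem_powersetCard_univ.1 (mem_filter.1 hS).1
  refine hfg S hc ?_
  exact (sum_eq_zero_iff_of_nonneg fun S hS =>
    hg S (mem_powersetCard_univ.1 (mem_filter.1 hS).1)).1 h S hS

lemma upSum_singleton (k : ℕ) (f : Finset α → ℝ) (i : α) :
    upSum k f {i} = ∑ S ∈ (univ : Finset α).powersetCard k, if i ∈ S then f S else 0 := by
  simp [upSum, sum_filter]

lemma upSum_empty (k : ℕ) (f : Finset α → ℝ) :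
    upSum k f ∅ = ∑ S ∈ (univ : Finset α).powersetCard k, f S := by
  simp [upSum]

end Combinatorics

section LogConcave

variable {n : ℕ}

lemma genPoly_nonneg {k : ℕ} {μ : Finset (Fin n) → ℝ}
    (hnn : ∀ S : Finset (Fin n), S.card = k → 0 ≤ μ S) {x : Fin n → ℝ} (hx : ∀ i, 0 ≤ x i) :
    0 ≤ genPoly n k μ x :=
  sum_nonneg fun S hS =>
    mul_nonneg (hnn S (mem_powersetCard_univ.1 hS)) (prod_nonneg fun i _ => hx i)

lemma genPoly_update (m : ℕ) (μ : Finset (Fin n) → ℝ) (i : Fin n) (x : Fin n → ℝ) (t : ℝ) :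
    genPoly n (m + 1) μ (Function.update x i t) =
      genPoly n (m + 1) μ (Function.update x i 0) + t * genPoly n m (link i μ) x := by
  have h : genPoly n m (link i μ) x = ∑ T ∈ (univ : Finset (Fin n)).powersetCard m,
      link i (fun S => μ S * ∏ j ∈ S.erase i, x j) T := by
    refine sum_congr rfl fun T _ => ?_
    by_cases hi : i ∈ T <;> simp [link, hi]
  rw [h, sum_link, genPoly, genPoly, mul_sum, ← sum_add_distrib]
  refine sum_congr rfl fun S _ => ?_
  by_cases hi : i ∈ S
  · have hp : ∀ s : ℝ, ∏ j ∈ S, Function.update x i s j = s * ∏ j ∈ S.erase i, x j := by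
      intro s
      rw [← mul_prod_erase S _ hi, Function.update_self]
      congr 1
      refine prod_congr rfl fun j hj => ?_
      rw [Function.update_of_ne (ne_of_mem_erase hj)]
    rw [hp, hp, if_pos hi]
    ring
  · have hp : ∀ s : ℝ, ∏ j ∈ S, Function.update x i s j = ∏ j ∈ S, x j := by
      intro s
      refine prod_congr rfl fun j hj => ?_
      rw [Function.update_of_ne (ne_of_mem_of_not_mem hj hi)]
    rw [hp, hp, if_neg hi]
    ring

lemma link_nonneg {m : ℕ} {f : Finset (Fin n) → ℝ}
    (hf : ∀ S : Finset (Fin n), S.card = m + 1 → 0 ≤ f S) (i : Fin n) :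
    ∀ T : Finset (Fin n), T.card = m → 0 ≤ link i f T := by
  intro T hT
  by_cases hi : i ∈ T
  · simp [link, hi]
  · rw [link, if_neg hi]
    exact hf _ (by rw [card_insert_of_notMem hi, hT])

lemma link_abs {m : ℕ} {f g : Finset (Fin n) → ℝ}
    (h : ∀ S : Finset (Fin n), S.card = m + 1 → g S = 0 → f S = 0) (i : Fin n) :
    ∀ T : Finset (Fin n), T.card = m → link i g T = 0 → link i f T = 0 := by
  intro T hT
  by_cases hi : i ∈ T
  · simp [link, hi]
  · rw [link, link, if_neg hi, if_neg hi]
    exact h _ (by rw [card_insert_of_notMem hi, hT])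

lemma logConcaveOn_link {m : ℕ} {μ : Finset (Fin n) → ℝ}
    (hnn : ∀ S : Finset (Fin n), S.card = m + 1 → 0 ≤ μ S)
    (hlc : LogConcaveOn (genPoly n (m + 1) μ)) (i : Fin n) :
    LogConcaveOn (genPoly n m (link i μ)) := by
  intro x y hx hy l hl0 hl1
  have hupd : ∀ w : Fin n → ℝ, (∀ j, 0 ≤ w j) → ∀ t : ℝ, 0 ≤ t →
      ∀ j, 0 ≤ Function.update w i t j := by
    intro w hw t ht j
    by_cases h : j = i
    · subst h; simpa using ht
    · simpa [Function.update_of_ne h] using hw j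
  set z : Fin n → ℝ := fun j => l * x j + (1 - l) * y j with hz
  have hge : ∀ w : Fin n → ℝ, (∀ j, 0 ≤ w j) → ∀ t : ℝ, 0 < t →
      genPoly n m (link i μ) w ≤ genPoly n (m + 1) μ (Function.update w i t) / t := by
    intro w hw t ht
    rw [le_div_iff₀ ht, genPoly_update]
    have := genPoly_nonneg hnn (hupd w hw 0 le_rfl)
    linarith
  have key : ∀ t : ℝ, 0 < t →
      genPoly n m (link i μ) x ^ l * genPoly n m (link i μ) y ^ (1 - l) ≤
        genPoly n (m + 1) μ (Function.update z i 0) * t⁻¹ + genPoly n m (link i μ) z := by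
    intro t ht
    have hx' := genPoly_nonneg hnn (hupd x hx t ht.le)
    have hy' := genPoly_nonneg hnn (hupd y hy t ht.le)
    have hlx := genPoly_nonneg (link_nonneg hnn i) hx
    have hly := genPoly_nonneg (link_nonneg hnn i) hy
    have hl1' : 0 ≤ 1 - l := sub_nonneg.2 hl1
    calc genPoly n m (link i μ) x ^ l * genPoly n m (link i μ) y ^ (1 - l)
        ≤ (genPoly n (m + 1) μ (Function.update x i t) / t) ^ l *
          (genPoly n (m + 1) μ (Function.update y i t) / t) ^ (1 - l) :=
          mul_le_mul (Real.rpow_le_rpow hlx (hge x hx t ht) hl0)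
            (Real.rpow_le_rpow hly (hge y hy t ht) hl1') (Real.rpow_nonneg hly _)
            (Real.rpow_nonneg (div_nonneg hx' ht.le) _)
      _ = (genPoly n (m + 1) μ (Function.update x i t) ^ l *
          genPoly n (m + 1) μ (Function.update y i t) ^ (1 - l)) / t := by
          rw [Real.div_rpow hx' ht.le, Real.div_rpow hy' ht.le, div_mul_div_comm,
            ← Real.rpow_add ht, add_sub_cancel, Real.rpow_one]
      _ ≤ genPoly n (m + 1) μ (Function.update z i t) / t := by
          refine div_le_div_of_nonneg_right ?_ ht.le
          refine (hlc _ _ (hupd x hx t ht.le) (hupd y hy t ht.le) l hl0 hl1).trans_eq ?_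
          congr 1
          funext j
          by_cases h : j = i
          · subst h; simp; ring
          · simp [Function.update_of_ne h, hz]
      _ = _ := by
          rw [genPoly_update]
          field_simp
  have hlim : Filter.Tendsto (fun t : ℝ => genPoly n (m + 1) μ (Function.update z i 0) * t⁻¹ +
      genPoly n m (link i μ) z) Filter.atTop (nhds (genPoly n m (link i μ) z)) := by
    simpa using (tendsto_inv_atTop_zero.const_mul
      (genPoly n (m + 1) μ (Function.update z i 0))).add_const (genPoly n m (link i μ) z)
  refine ge_of_tendsto hlim ?_
  filter_upwards [Filter.eventually_gt_atTop 0] with t ht using key t ht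

lemma deriv_nonneg_of_nonneg_right {F : ℝ → ℝ} {F' : ℝ} (h0 : F 0 = 0)
    (hF : ∀ t, 0 ≤ t → t ≤ 1 → 0 ≤ F t) (hd : HasDerivAt F F' 0) : 0 ≤ F' := by
  have h := hd.tendsto_slope.mono_left
    (nhdsWithin_mono 0 fun t (ht : t ∈ Set.Ioi (0 : ℝ)) => ne_of_gt ht)
  refine ge_of_tendsto h ?_
  filter_upwards [Ioo_mem_nhdsGT (zero_lt_one' ℝ)] with t ht
  rw [slope_def_field, h0, sub_zero, sub_zero]
  exact div_nonneg (hF t ht.1.le ht.2.le) ht.1.le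

lemma genPoly_one (k : ℕ) (μ : Finset (Fin n) → ℝ) :
    genPoly n k μ (fun _ => 1) = ∑ S ∈ (univ : Finset (Fin n)).powersetCard k, μ S := by
  simp [genPoly]

/-- A log-concave polynomial lies below its value at `1` on the half-space where its
derivative at `1` is nonpositive. -/
lemma LogConcaveOn.genPoly_le_one {k : ℕ} {μ : Finset (Fin n) → ℝ}
    (hlc : LogConcaveOn (genPoly n k μ)) {z : Fin n → ℝ} (hz : ∀ i, 0 ≤ z i)
    (hpos : 0 < genPoly n k μ (fun _ => 1))
    (hder : ∑ S ∈ (univ : Finset (Fin n)).powersetCard k, μ S * ∑ i ∈ S, (z i - 1) ≤ 0) :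
    genPoly n k μ z ≤ genPoly n k μ (fun _ => 1) := by
  by_contra! hlt
  have hzpos := hpos.trans hlt
  set a := genPoly n k μ z
  set b := genPoly n k μ (fun _ => 1)
  have h1 : HasDerivAt (fun t : ℝ => genPoly n k μ (fun i => t * z i + (1 - t) * 1))
      (∑ S ∈ (univ : Finset (Fin n)).powersetCard k, μ S * ∑ i ∈ S, (z i - 1)) 0 := by
    unfold genPoly
    refine HasDerivAt.fun_sum fun S _ => HasDerivAt.const_mul _ ?_
    have hi : ∀ i ∈ S, HasDerivAt (fun t : ℝ => t * z i + (1 - t) * 1) (z i - 1) 0 := by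
      intro i _
      exact (((hasDerivAt_id (0 : ℝ)).mul_const (z i)).add
        (((hasDerivAt_id (0 : ℝ)).const_sub 1).mul_const 1)).congr_deriv (by ring)
    convert HasDerivAt.fun_finsetProd hi using 1
    simp
  have h2 : HasDerivAt (fun t : ℝ => a ^ t * b ^ (1 - t))
      (b * (Real.log a - Real.log b)) 0 := by
    refine (((hasDerivAt_id (0 : ℝ)).const_rpow hzpos).mul
      (((hasDerivAt_id (0 : ℝ)).const_sub 1).const_rpow hpos)).congr_deriv ?_
    simp
    ring
  have h3 := deriv_nonneg_of_nonneg_right (F := fun t : ℝ =>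
      genPoly n k μ (fun i => t * z i + (1 - t) * 1) - a ^ t * b ^ (1 - t))
    (by simp [b]) (fun t ht0 ht1 => sub_nonneg.2
      (hlc z (fun _ => 1) hz (fun _ => zero_le_one) t ht0 ht1)) (h1.sub h2)
  have h4 := mul_pos hpos (sub_pos.2 (Real.log_lt_log hpos hlt))
  linarith

end LogConcave

section Entropy

variable {n : ℕ}

lemma sum_upSum_singleton_mul (k : ℕ) (f : Finset (Fin n) → ℝ) (c : Fin n → ℝ) :
    ∑ i, upSum k f {i} * c i =
      ∑ S ∈ (univ : Finset (Fin n)).powersetCard k, f S * ∑ i ∈ S, c i := by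
  simp only [upSum_singleton, sum_mul, ite_mul, zero_mul]
  rw [sum_sum_mem k fun i S => f S * c i]
  simp only [mul_sum]

lemma sum_mul_card (k : ℕ) (f : Finset (Fin n) → ℝ) :
    ∑ S ∈ (univ : Finset (Fin n)).powersetCard k, f S * ∑ _i ∈ S, (1 : ℝ) =
      k * upSum k f ∅ := by
  rw [upSum_empty, mul_sum]
  refine sum_congr rfl fun S hS => ?_
  rw [sum_const, mem_powersetCard_univ.1 hS, nsmul_eq_mul, mul_one, mul_comm]

/-- Entropic independence of weights with a log-concave generating polynomial. -/
lemma sum_upSum_singleton_log_le {k : ℕ} {f g : Finset (Fin n) → ℝ}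
    (hf : ∀ S : Finset (Fin n), S.card = k → 0 ≤ f S)
    (hg : ∀ S : Finset (Fin n), S.card = k → 0 ≤ g S)
    (hfg : ∀ S : Finset (Fin n), S.card = k → g S = 0 → f S = 0)
    (hlc : LogConcaveOn (genPoly n k g)) :
    ∑ i, upSum k f {i} * Real.log (upSum k f {i} / upSum k g {i}) ≤
      relEnt k f g + (k - 1) * (upSum k f ∅ * Real.log (upSum k f ∅ / upSum k g ∅)) := by
  rcases (upSum_nonneg hf ∅).eq_or_lt with h0 | hA
  · have hf0 : ∀ S ∈ (univ : Finset (Fin n)).powersetCard k, f S = 0 := by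
      rw [upSum_empty] at h0
      exact (sum_eq_zero_iff_of_nonneg fun S hS => hf S (mem_powersetCard_univ.1 hS)).1 h0.symm
    have h1 : ∀ T, upSum k f T = 0 := fun T => sum_eq_zero fun S hS => hf0 S (mem_filter.1 hS).1
    have h2 : relEnt k f g = 0 := sum_eq_zero fun S hS => by rw [hf0 S hS, zero_mul]
    simp [h1, h2]
  have hB : 0 < upSum k g ∅ :=
    (upSum_nonneg hg ∅).lt_of_ne fun h => hA.ne' (upSum_eq_zero hg hfg h.symm)
  set A := upSum k f ∅ with hAdef
  set B := upSum k g ∅ with hBdef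
  set c := A / B with hc
  have hcpos : 0 < c := div_pos hA hB
  set z : Fin n → ℝ := fun i => upSum k f {i} / upSum k g {i} / c with hz
  have hz0 : ∀ i, 0 ≤ z i := fun i =>
    div_nonneg (div_nonneg (upSum_nonneg hf _) (upSum_nonneg hg _)) hcpos.le
  have hone : genPoly n k g (fun _ => 1) = B := by rw [genPoly_one, hBdef, upSum_empty]
  have hle : genPoly n k g z ≤ B := by
    rw [← hone]
    refine hlc.genPoly_le_one hz0 (hone.symm ▸ hB) ?_
    simp only [sum_sub_distrib, mul_sub]
    rw [← sum_upSum_singleton_mul, sum_mul_card, ← hBdef]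
    have h1 : ∀ i, upSum k g {i} * z i = upSum k f {i} * c⁻¹ := by
      intro i
      by_cases h : upSum k g {i} = 0
      · rw [h, upSum_eq_zero hg hfg h, zero_mul, zero_mul]
      · simp only [hz]
        field_simp
    have h2 : ∑ i, upSum k f {i} * c⁻¹ = k * A * c⁻¹ := by
      rw [← sum_mul]
      have := sum_upSum_singleton_mul k f fun _ => 1
      simp only [mul_one] at this
      rw [this]
      have := sum_mul_card k f
      rw [this]
    simp only [h1]
    rw [h2, hc]
    apply le_of_eq
    field_simp
    ring
  have hpt : ∀ S ∈ (univ : Finset (Fin n)).powersetCard k,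
      f S * Real.log c + f S * ∑ i ∈ S, Real.log (z i) - f S * Real.log (f S / g S) ≤
        c * (g S * ∏ i ∈ S, z i) - f S := by
    intro S hS
    have hcard := mem_powersetCard_univ.1 hS
    rcases (hf S hcard).eq_or_lt with h | hfS
    · rw [← h]
      have := mul_nonneg hcpos.le (mul_nonneg (hg S hcard) (prod_nonneg fun i (_ : i ∈ S) => hz0 i))
      simpa using this
    have hgS : 0 < g S := (hg S hcard).lt_of_ne fun h => hfS.ne' (hfg S hcard h.symm)
    have hmem : ∀ φ : Finset (Fin n) → ℝ, (∀ S : Finset (Fin n), S.card = k → 0 ≤ φ S) →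
        0 < φ S → ∀ i ∈ S, 0 < upSum k φ {i} := by
      intro φ hφ hφS i hi
      refine hφS.trans_le (single_le_sum (f := φ) (fun S hS => hφ S ?_) ?_)
      · exact mem_powersetCard_univ.1 (mem_filter.1 hS).1
      · exact mem_filter.2 ⟨hS, by simpa using hi⟩
    have hzpos : ∀ i ∈ S, 0 < z i := fun i hi =>
      div_pos (div_pos (hmem f hf hfS i hi) (hmem g hg hgS i hi)) hcpos
    have hw : 0 < ∏ i ∈ S, z i := prod_pos hzpos
    have hlog := Real.log_le_sub_one_of_pos (div_pos (mul_pos hcpos (mul_pos hgS hw)) hfS)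
    have hexp : Real.log (c * (g S * ∏ i ∈ S, z i) / f S) =
        Real.log c + ∑ i ∈ S, Real.log (z i) - Real.log (f S / g S) := by
      rw [Real.log_div (mul_pos hcpos (mul_pos hgS hw)).ne' hfS.ne',
        Real.log_mul hcpos.ne' (mul_pos hgS hw).ne', Real.log_mul hgS.ne' hw.ne',
        Real.log_prod fun i hi => (hzpos i hi).ne', Real.log_div hfS.ne' hgS.ne']
      ring
    rw [hexp] at hlog
    have := mul_le_mul_of_nonneg_left hlog hfS.le
    rw [mul_sub, mul_sub _ (_ / _), mul_div_cancel₀ _ hfS.ne'] at this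
    linarith
  have hsum := sum_le_sum hpt
  rw [sum_sub_distrib, sum_sub_distrib, sum_add_distrib, ← sum_mul, ← mul_sum,
    ← upSum_empty, ← sum_upSum_singleton_mul] at hsum
  have hlogz : ∀ i, upSum k f {i} * Real.log (z i) =
      upSum k f {i} * Real.log (upSum k f {i} / upSum k g {i}) -
        upSum k f {i} * Real.log c := by
    intro i
    by_cases h : upSum k f {i} = 0
    · simp [h]
    · have hgi : upSum k g {i} ≠ 0 := fun h' => h (upSum_eq_zero hg hfg h')
      rw [← mul_sub, ← Real.log_div (div_ne_zero h hgi) hcpos.ne']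
  have htot : ∑ i, upSum k f {i} * Real.log c = k * A * Real.log c := by
    rw [sum_upSum_singleton_mul k f fun _ => Real.log c]
    rw [hAdef, ← sum_mul_card, sum_mul]
    refine sum_congr rfl fun S _ => ?_
    simp [mul_assoc]
  simp only [hlogz, sum_sub_distrib] at hsum
  rw [htot, ← hAdef] at hsum
  have hcB : c * genPoly n k g z ≤ A := by
    calc c * genPoly n k g z ≤ c * B := mul_le_mul_of_nonneg_left hle hcpos.le
      _ = A := div_mul_cancel₀ _ hB.ne'
  simp only [relEnt, genPoly] at hcB ⊢
  linarith

/-- Contraction of relative entropy under the down step. -/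
lemma relEnt_upSum_le (m : ℕ) : ∀ {f g : Finset (Fin n) → ℝ},
    (∀ S : Finset (Fin n), S.card = m + 1 → 0 ≤ f S) →
    (∀ S : Finset (Fin n), S.card = m + 1 → 0 ≤ g S) →
    (∀ S : Finset (Fin n), S.card = m + 1 → g S = 0 → f S = 0) →
    LogConcaveOn (genPoly n (m + 1) g) →
    relEnt m (upSum (m + 1) f) (upSum (m + 1) g) ≤ m * relEnt (m + 1) f g +
      upSum (m + 1) f ∅ * Real.log (upSum (m + 1) f ∅ / upSum (m + 1) g ∅) := by
  induction m with
  | zero =>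
    intro f g _ _ _ _
    simp [relEnt]
  | succ m ih =>
    intro f g hf hg hfg hlc
    have hEI := sum_upSum_singleton_log_le hf hg hfg hlc
    have hlink : ∀ i, relEnt m (link i (upSum (m + 2) f)) (link i (upSum (m + 2) g)) ≤
        m * relEnt (m + 1) (link i f) (link i g) +
          upSum (m + 2) f {i} * Real.log (upSum (m + 2) f {i} / upSum (m + 2) g {i}) := by
      intro i
      have h := ih (link_nonneg hf i) (link_nonneg hg i) (link_abs hfg i)
        (logConcaveOn_link hg hlc i)
      simpa [upSum_link, link] using h
    have hsum := sum_le_sum fun i (_ : i ∈ univ) => hlink i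
    rw [sum_add_distrib, ← mul_sum, sum_relEnt_link, sum_relEnt_link] at hsum
    push_cast at hsum hEI ⊢
    have hm : (0 : ℝ) < m + 1 := by positivity
    refine le_of_mul_le_mul_left ?_ hm
    linarith

end Entropy

lemma sum_mul_log_div_mul {α : Type*} [Fintype α] (k : ℕ) {f g : Finset α → ℝ}
    (hfg : ∀ S : Finset α, S.card = k → g S = 0 → f S = 0) {c : ℝ} (hc : c ≠ 0) :
    ∑ S ∈ (univ : Finset α).powersetCard k, f S * Real.log (f S / g S * c) =
      relEnt k f g + (∑ S ∈ (univ : Finset α).powersetCard k, f S) * Real.log c := by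
  rw [relEnt, sum_mul, ← sum_add_distrib]
  refine sum_congr rfl fun S hS => ?_
  by_cases h : f S = 0
  · simp [h]
  · rw [Real.log_mul (div_ne_zero h fun h' => h (hfg S (mem_powersetCard_univ.1 hS) h')) hc]
    ring

lemma mean_mul_log_le {α : Type*} {S : Finset α} {k : ℕ} (hS : S.card = k) (hk : 0 < k) {c : ℝ}
    (hc : 0 < c) {r : α → ℝ} (hr : ∀ e ∈ S, 0 ≤ r e) :
    (1 / (k : ℝ) * ∑ e ∈ S, r e) * Real.log ((1 / (k : ℝ) * ∑ e ∈ S, r e) * c) ≤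
      1 / (k : ℝ) * ∑ e ∈ S, r e * Real.log (r e * c) := by
  have hk' : (0 : ℝ) < k := Nat.cast_pos.2 hk
  have h := Real.convexOn_mul_log.map_sum_le (t := S) (w := fun _ => 1 / (k : ℝ))
    (p := fun e => r e * c) (fun _ _ => by positivity)
    (by rw [sum_const, hS, nsmul_eq_mul]; field_simp)
    (fun e he => mul_nonneg (hr e he) hc.le)
  simp only [smul_eq_mul, ← mul_sum, ← sum_mul, ← mul_assoc] at h
  have h2 : ∑ e ∈ S, 1 / (k : ℝ) * r e * c * Real.log (r e * c) =
      c * (1 / (k : ℝ) * ∑ e ∈ S, r e * Real.log (r e * c)) := by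
    simp only [mul_sum]
    exact sum_congr rfl fun e _ => by ring
  rw [h2] at h
  refine le_of_mul_le_mul_left ?_ hc
  linarith

section DownUp

variable {α : Type*} [DecidableEq α] [Fintype α]

lemma sum_mul_downUp (m : ℕ) {μ ν : Finset α → ℝ}
    (habs : ∀ S : Finset α, S.card = m + 1 → μ S = 0 → ν S = 0)
    {S' : Finset α} (hS' : S'.card = m + 1) :
    ∑ S ∈ (univ : Finset α).powersetCard (m + 1), ν S * downUp univ (m + 1) μ S S' =
      μ S' * ((1 / ((m + 1 : ℕ) : ℝ)) *
        ∑ e ∈ S', upSum (m + 1) ν (S' \ {e}) / upSum (m + 1) μ (S' \ {e})) := by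
  have h : ∀ S ∈ (univ : Finset α).powersetCard (m + 1),
      ν S * downUp univ (m + 1) μ S S' = (1 / ((m + 1 : ℕ) : ℝ)) * (ν S * ∑ e ∈ S,
        (fun T => if T ⊆ S' then μ S' / upSum (m + 1) μ T else 0) (S \ {e})) := by
    intro S hS
    by_cases hμ : μ S = 0
    · simp [habs S (mem_powersetCard_univ.1 hS) hμ]
    · rw [downUp, if_neg hμ]
      simp only [upSum]
      ring
  rw [sum_congr rfl h, ← mul_sum, sum_mul_sum_erase m ν fun T =>
      if T ⊆ S' then μ S' / upSum (m + 1) μ T else 0,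
    sum_erase_eq_sum_subset hS' fun T => upSum (m + 1) ν T / upSum (m + 1) μ T,
    mul_left_comm, mul_sum (a := μ S')]
  congr 1
  refine sum_congr rfl fun T _ => ?_
  split_ifs <;> ring

lemma klDiv_statDist (k : ℕ) {μ ν : Finset α → ℝ}
    (hν : ∀ S : Finset α, S.card = k → 0 ≤ ν S) :
    klDiv univ k ν (statDist univ k μ) =
      ∑ S ∈ (univ : Finset α).powersetCard k,
        ν S * Real.log (ν S / μ S * upSum k μ ∅) := by
  refine sum_congr rfl fun S hS => ?_
  rw [statDist, ← upSum_empty, div_div_eq_mul_div, div_mul_eq_mul_div]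
  split_ifs with h
  · rfl
  · rw [le_antisymm (not_lt.1 h) (hν S (mem_powersetCard_univ.1 hS)), zero_mul]

lemma sum_upSum (m : ℕ) (f : Finset α → ℝ) :
    ∑ T ∈ (univ : Finset α).powersetCard m, upSum (m + 1) f T =
      (m + 1) * ∑ S ∈ (univ : Finset α).powersetCard (m + 1), f S := by
  have h := sum_mul_sum_erase m f fun _ => 1
  simp only [mul_one] at h
  rw [← h, mul_sum]
  refine sum_congr rfl fun S hS => ?_
  rw [sum_const, mem_powersetCard_univ.1 hS, nsmul_eq_mul]
  push_cast
  ring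

/-- Data processing for the up step. -/
lemma klDiv_downUp_le (m : ℕ) {μ ν : Finset α → ℝ}
    (hμ : ∀ S : Finset α, S.card = m + 1 → 0 ≤ μ S)
    (hν : ∀ S : Finset α, S.card = m + 1 → 0 ≤ ν S)
    (habs : ∀ S : Finset α, S.card = m + 1 → μ S = 0 → ν S = 0)
    (hZ : 0 < upSum (m + 1) μ ∅) :
    klDiv univ (m + 1)
        (fun S' => ∑ S ∈ (univ : Finset α).powersetCard (m + 1),
          ν S * downUp univ (m + 1) μ S S') (statDist univ (m + 1) μ) ≤
      1 / ((m + 1 : ℕ) : ℝ) * ∑ T ∈ (univ : Finset α).powersetCard m,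
        upSum (m + 1) ν T *
          Real.log (upSum (m + 1) ν T / upSum (m + 1) μ T * upSum (m + 1) μ ∅) := by
  set Z := upSum (m + 1) μ ∅
  set R : Finset α → ℝ := fun T => upSum (m + 1) ν T / upSum (m + 1) μ T with hR
  have hR0 : ∀ T, 0 ≤ R T := fun T => div_nonneg (upSum_nonneg hν T) (upSum_nonneg hμ T)
  rw [klDiv_statDist]
  · calc _ ≤ ∑ S' ∈ (univ : Finset α).powersetCard (m + 1), 1 / ((m + 1 : ℕ) : ℝ) *
          (μ S' * ∑ e ∈ S', (fun T => R T * Real.log (R T * Z)) (S' \ {e})) := by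
          refine sum_le_sum fun S' hS' => ?_
          have hcard := mem_powersetCard_univ.1 hS'
          rw [sum_mul_downUp m habs hcard]
          by_cases h : μ S' = 0
          · simp [h]
          rw [mul_div_cancel_left₀ _ h, mul_assoc, mul_left_comm (1 / _)]
          exact mul_le_mul_of_nonneg_left (mean_mul_log_le hcard m.succ_pos hZ
            (r := fun e => R (S' \ {e})) fun e _ => hR0 _) (hμ S' hcard)
      _ = _ := by
          rw [← mul_sum, sum_mul_sum_erase m μ fun T => R T * Real.log (R T * Z)]
          congr 1
          refine sum_congr rfl fun T _ => ?_
          rw [← mul_assoc]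
          congr 1
          by_cases h : upSum (m + 1) μ T = 0
          · rw [h, upSum_eq_zero hμ habs h, zero_mul]
          · exact mul_div_cancel₀ _ h
  · intro S' hS'
    rw [sum_mul_downUp m habs hS']
    exact mul_nonneg (hμ S' hS') (mul_nonneg (by positivity) (sum_nonneg fun e _ => hR0 _))

end DownUp

/-- **Modified log-Sobolev-type contraction (Cryan–Guo–Mousa):** for `μ` with a log-concave
generating polynomial, one step of the down-up walk contracts KL divergence to `π_μ` by a
factor `1 − 1/k`. -/
theorem klDiv_contraction (n k : ℕ) (hk1 : 1 ≤ k) (hkn : k ≤ n)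
    (μ : Finset (Fin n) → ℝ) (hnn : ∀ S : Finset (Fin n), S.card = k → 0 ≤ μ S)
    (hne : ∃ S : Finset (Fin n), S.card = k ∧ μ S ≠ 0)
    (hlc : LogConcaveOn (genPoly n k μ))
    (ν : Finset (Fin n) → ℝ) (hνnn : ∀ S : Finset (Fin n), S.card = k → 0 ≤ ν S)
    (hνsum : ∑ S ∈ Finset.powersetCard k (Finset.univ : Finset (Fin n)), ν S = 1)
    (habs : ∀ S : Finset (Fin n), S.card = k → μ S = 0 → ν S = 0) :
    klDiv (Finset.univ : Finset (Fin n)) k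
        (fun S' => ∑ S ∈ Finset.powersetCard k (Finset.univ : Finset (Fin n)),
          ν S * downUp Finset.univ k μ S S')
        (statDist Finset.univ k μ) ≤
      (1 - 1 / (k : ℝ)) * klDiv Finset.univ k ν (statDist Finset.univ k μ) := by
  obtain ⟨m, rfl⟩ := Nat.exists_eq_add_of_le' hk1
  have hZ : 0 < upSum (m + 1) μ ∅ := by
    obtain ⟨S, hS, hSne⟩ := hne
    rw [upSum_empty]
    exact sum_pos' (fun T hT => hnn T (mem_powersetCard_univ.1 hT))
      ⟨S, mem_powersetCard_univ.2 hS, (hnn S hS).lt_of_ne' hSne⟩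
  refine (klDiv_downUp_le m hnn hνnn habs hZ).trans ?_
  have hν1 : upSum (m + 1) ν ∅ = 1 := by rw [upSum_empty, hνsum]
  have hdown := relEnt_upSum_le m hνnn hnn habs hlc
  rw [hν1, one_mul, one_div, Real.log_inv] at hdown
  rw [klDiv_statDist (m + 1) hνnn, sum_mul_log_div_mul (m + 1) habs hZ.ne',
    sum_mul_log_div_mul m (fun T _ => upSum_eq_zero hnn habs) hZ.ne', sum_upSum, hνsum]
  push_cast
  have hm : (0 : ℝ) < m + 1 := by positivity
  refine le_of_mul_le_mul_left ?_ hm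
  field_simp
  linarith
end

section
/- There exists a universal constant C > 0 with the following property. Let G be a finite connected simple graph with vertex set V and edge set E, |E| = n ≥ 1, let k = n − (|V| − 1), assume k ≥ 1, and define μ on the k-element subsets S of E by μ(S) = 1 if E∖S is the edge set of a spanning tree of G (i.e., the subgraph (V, E∖S) is connected and |E∖S| = |V|−1) and μ(S) = 0 otherwise. Then for every starting set S₀ with μ(S₀) = 1, every ε ∈ (0,1), and every integer t ≥ C·n·(log n + log(1/ε) + 1), the down-up walk for μ satisfies ‖Pᵗ(S₀,·) − π_μ‖_TV ≤ ε, where π_μ is the uniform distribution on complements of spanning trees. -/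
open Finset
open scoped Classical

/-- The distribution of the down-up walk after `t` steps started from `S₀`. -/
noncomputable def walkDist {α : Type*} [DecidableEq α] (ground : Finset α) (k : ℕ)
    (μ : Finset α → ℝ) (S₀ : Finset α) : ℕ → Finset α → ℝ
  | 0 => fun S => if S = S₀ then 1 else 0
  | t + 1 => fun S' =>
      ∑ S ∈ ground.powersetCard k, walkDist ground k μ S₀ t S * downUp ground k μ S S'

/-- Total variation distance between two functions on the `k`-subsets of `ground`. -/
noncomputable def tvDist {α : Type*} [DecidableEq α] (ground : Finset α) (k : ℕ)
    (ν π : Finset α → ℝ) : ℝ :=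
  (1 / 2) * ∑ S ∈ ground.powersetCard k, |ν S - π S|

/-- The indicator of complements of spanning trees: `μ(S) = 1` iff `S` is a `k`-element
subset of the edge set `E` of `G` such that `E ∖ S` is the edge set of a spanning tree of `G`
(i.e. `(V, E∖S)` is connected and `|E∖S| = |V| − 1`). -/
noncomputable def coTreeIndicator {V : Type*} [Fintype V] [DecidableEq V]
    (G : SimpleGraph V) [DecidableRel G.Adj] (k : ℕ) (S : Finset (Sym2 V)) : ℝ :=
  if S ⊆ G.edgeFinset ∧ S.card = k ∧
      (G.edgeFinset \ S).card = Fintype.card V - 1 ∧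
      (SimpleGraph.fromEdgeSet ((G.edgeFinset \ S : Finset (Sym2 V)) : Set (Sym2 V))).Connected
  then 1 else 0

/-- The quadratic form of `W` is dominated by its restriction to the all-ones direction; for a
nonnegative symmetric `W` this says that `W` has at most one positive eigenvalue. -/
def OnesDominate {ι : Type*} [Fintype ι] (W : ι → ι → ℝ) : Prop :=
  ∀ x : ι → ℝ, (∑ i, ∑ j, W i j) * (∑ i, ∑ j, W i j * x i * x j) ≤ (∑ i, (∑ j, W i j) * x i) ^ 2

theorem quadForm_sub_const {ι : Type*} [Fintype ι] {W : ι → ι → ℝ}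
    (hsymm : ∀ i j, W i j = W j i) (x : ι → ℝ) (s : ℝ) :
    ∑ i, ∑ j, W i j * (x i - s) * (x j - s) = (∑ i, ∑ j, W i j * x i * x j)
      - 2 * s * (∑ i, (∑ j, W i j) * x i) + s ^ 2 * ∑ i, ∑ j, W i j := by
  have hl : ∑ i, ∑ j, W i j * x j = ∑ i, (∑ j, W i j) * x i := by
    rw [sum_comm]
    refine sum_congr rfl fun i _ => ?_
    rw [sum_mul]
    exact sum_congr rfl fun j _ => by rw [hsymm]
  have hr : ∑ i, ∑ j, W i j * x i = ∑ i, (∑ j, W i j) * x i := by simp_rw [sum_mul]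
  rw [mul_assoc, two_mul]
  nth_rewrite 1 [← hl]
  rw [← hr]
  simp only [mul_sum, ← sum_sub_distrib, ← sum_add_distrib]
  refine sum_congr rfl fun i _ => sum_congr rfl fun j _ => ?_
  ring

theorem onesDominate_of_centered {ι : Type*} [Fintype ι] {W : ι → ι → ℝ}
    (hsymm : ∀ i j, W i j = W j i) (hnn : ∀ i j, 0 ≤ W i j)
    (hc : ∀ x : ι → ℝ, ∑ i, (∑ j, W i j) * x i = 0 → ∑ i, ∑ j, W i j * x i * x j ≤ 0) :
    OnesDominate W := by
  intro x
  set D := ∑ i, ∑ j, W i j with hD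
  set L := ∑ i, (∑ j, W i j) * x i with hL
  have hD0 : 0 ≤ D := sum_nonneg fun i _ => sum_nonneg fun j _ => hnn i j
  rcases hD0.eq_or_lt with h0 | hpos
  · rw [← h0, zero_mul]; positivity
  have key := hc (fun i => x i - L / D) (by
    simp_rw [mul_sub, sum_sub_distrib, ← sum_mul]
    rw [← hD, ← hL]
    field_simp
    ring)
  rw [quadForm_sub_const hsymm, ← hD, ← hL] at key
  have e : D * ((∑ i, ∑ j, W i j * x i * x j) - 2 * (L / D) * L + (L / D) ^ 2 * D)
      = D * (∑ i, ∑ j, W i j * x i * x j) - L ^ 2 := by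
    field_simp; ring
  linarith [mul_nonpos_of_nonneg_of_nonpos hD0 key]

theorem onesDominate_of_multipartite {ι : Type*} [Fintype ι] {W : ι → ι → ℝ}
    (hsymm : ∀ i j, W i j = W j i) (h01 : ∀ i j, W i j = 0 ∨ W i j = 1) (hdiag : ∀ i, W i i = 0)
    (htrans : ∀ i l m q, W i l = 1 → W m q = 1 → W i m = 1 ∨ W l m = 1) :
    OnesDominate W := by
  have hnn : ∀ i j, 0 ≤ W i j := fun i j => by rcases h01 i j with h | h <;> simp [h]
  let N : Finset ι := univ.filter fun i => ∃ q, W i q = 1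
  have hN : ∀ i, i ∈ N ↔ ∃ q, W i q = 1 := fun i => by simp [N]
  let p : ι → Finset ι := fun i => N.filter fun j => W i j = 0
  have hp : ∀ i ∈ N, ∀ j ∈ N, (p i = p j ↔ W i j = 0) := by
    intro i hi j hj
    constructor
    · intro h
      have : j ∈ p j := by simp [p, hj, hdiag]
      rw [← h] at this
      exact (mem_filter.1 this).2
    · intro h
      ext m
      simp only [p, mem_filter]
      refine and_congr_right fun hm => ?_
      obtain ⟨q, hq⟩ := (hN i).1 hi
      obtain ⟨q', hq'⟩ := (hN j).1 hj
      constructor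
      · intro h1
        by_contra h2
        have h3 := (h01 j m).resolve_left h2
        rcases htrans j m i q h3 hq with h4 | h4
        · rw [hsymm, h] at h4; norm_num at h4
        · rw [hsymm, h1] at h4; norm_num at h4
      · intro h1
        by_contra h2
        have h3 := (h01 i m).resolve_left h2
        rcases htrans i m j q' h3 hq' with h4 | h4
        · rw [h] at h4; norm_num at h4
        · rw [hsymm, h1] at h4; norm_num at h4
  have hW : ∀ i j, W i j = if i ∈ N then (if j ∈ N then (1 - if p i = p j then 1 else 0) else 0)
      else 0 := by
    intro i j
    by_cases hi : i ∈ N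
    · by_cases hj : j ∈ N
      · rw [if_pos hi, if_pos hj]
        rcases h01 i j with h | h
        · rw [if_pos ((hp i hi j hj).2 h), h]; norm_num
        · rw [if_neg (fun h' => by rw [(hp i hi j hj).1 h'] at h; norm_num at h), h]; norm_num
      · rw [if_pos hi, if_neg hj]
        exact (h01 i j).resolve_right fun h => hj ((hN j).2 ⟨i, by rw [hsymm, h]⟩)
    · rw [if_neg hi]
      exact (h01 i j).resolve_right fun h => hi ((hN i).2 ⟨j, h⟩)
  have hform : ∀ x : ι → ℝ, ∑ i, ∑ j, W i j * x i * x j ≤ (∑ i ∈ N, x i) ^ 2 := by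
    intro x
    have e1 : ∑ i, ∑ j, W i j * x i * x j
        = ∑ i ∈ N, ∑ j ∈ N, (x i * x j - if p i = p j then x i * x j else 0) := by
      rw [← sum_filter_add_sum_filter_not univ (· ∈ N), filter_univ_mem]
      rw [sum_eq_zero (s := univ.filter (· ∉ N)), add_zero]
      · refine sum_congr rfl fun i hi => ?_
        rw [← sum_filter_add_sum_filter_not univ (· ∈ N), filter_univ_mem]
        rw [sum_eq_zero (s := univ.filter (· ∉ N)), add_zero]
        · refine sum_congr rfl fun j hj => ?_
          rw [hW, if_pos hi, if_pos hj]
          split_ifs <;> ring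
        · intro j hj
          rw [hW, if_pos hi, if_neg (mem_filter.1 hj).2]; ring
      · intro i hi
        refine sum_eq_zero fun j _ => ?_
        rw [hW, if_neg (mem_filter.1 hi).2]; ring
    have e2 : ∑ i ∈ N, ∑ j ∈ N, (if p i = p j then x i * x j else 0)
        = ∑ b ∈ N.image p, (∑ i ∈ N with p i = b, x i) ^ 2 := by
      rw [← sum_fiberwise_of_maps_to (fun i hi => mem_image_of_mem p hi)]
      refine sum_congr rfl fun b _ => ?_
      rw [sq, sum_mul_sum]
      refine sum_congr rfl fun i hi => ?_
      rw [sum_filter (s := N)]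
      refine sum_congr rfl fun j _ => ?_
      rw [(mem_filter.1 hi).2]
      simp only [eq_comm]
    rw [e1]
    simp_rw [sum_sub_distrib]
    rw [e2, sq, sum_mul_sum]
    have : 0 ≤ ∑ b ∈ N.image p, (∑ i ∈ N with p i = b, x i) ^ 2 :=
      sum_nonneg fun b _ => sq_nonneg _
    linarith
  intro x
  set D := ∑ i, ∑ j, W i j with hD
  set L := ∑ i, (∑ j, W i j) * x i with hL
  set u := ∑ i ∈ N, x i
  have hD0 : 0 ≤ D := sum_nonneg fun i _ => sum_nonneg fun j _ => hnn i j
  rcases hD0.eq_or_lt with h0 | hpos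
  · rw [← h0, zero_mul]; positivity
  have hNpos : 0 < (N.card : ℝ) := by
    have h1 := hform (fun _ => 1)
    simp only [mul_one, sum_const, nsmul_eq_mul] at h1
    rw [← hD] at h1
    rcases (Nat.cast_nonneg N.card : (0:ℝ) ≤ N.card).eq_or_lt with h | h
    · rw [← h] at h1; norm_num at h1; linarith
    · exact h
  have h2 := hform (fun i => x i - u / N.card)
  rw [quadForm_sub_const hsymm, ← hD, ← hL, sum_sub_distrib, sum_const, nsmul_eq_mul,
    mul_div_cancel₀ _ hNpos.ne'] at h2
  have h3 : ∑ i ∈ N, x i - u = 0 := sub_self _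
  rw [h3] at h2
  nlinarith [sq_nonneg (L - u / N.card * D), mul_nonneg hD0 (sub_nonneg.2 h2)]

theorem exists_eigenbasis_dotProduct {ι : Type*} [Fintype ι] {A : Matrix ι ι ℝ}
    (hA : A.IsSymm) : ∃ (l : ι → ℝ) (b : ι → ι → ℝ),
      (∀ a, A.mulVec (b a) = l a • b a) ∧ (∀ a, b a ⬝ᵥ b a = 1) ∧
      ∀ y z : ι → ℝ, y ⬝ᵥ z = ∑ a, (y ⬝ᵥ b a) * (b a ⬝ᵥ z) := by
  have hH : A.IsHermitian := by
    rwa [Matrix.IsHermitian, Matrix.conjTranspose_eq_transpose_of_trivial]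
  have hin : ∀ y z : EuclideanSpace ℝ ι, inner ℝ y z = y.ofLp ⬝ᵥ z.ofLp := fun y z => by
    rw [EuclideanSpace.inner_eq_star_dotProduct, star_trivial, dotProduct_comm]
  refine ⟨hH.eigenvalues, fun a => (hH.eigenvectorBasis a).ofLp, fun a => ?_, fun a => ?_,
    fun y z => ?_⟩
  · exact hH.mulVec_eigenvectorBasis a
  · rw [← hin, real_inner_self_eq_norm_sq, hH.eigenvectorBasis.norm_eq_one, one_pow]
  · have := hH.eigenvectorBasis.sum_inner_mul_inner (WithLp.toLp 2 y) (WithLp.toLp 2 z)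
    simp only [hin] at this
    exact this.symm

theorem onesDominate_of_quadForm_le {ι : Type*} [Fintype ι] {W : ι → ι → ℝ}
    (hsymm : ∀ i j, W i j = W j i) (hnn : ∀ i j, 0 ≤ W i j)
    (hle : ∀ x : ι → ℝ, ∑ i, ∑ j, W i j * x i * x j
      ≤ ∑ i, (∑ j, W i j * x j) ^ 2 / ∑ j, W i j)
    (hconn : ∀ x : ι → ℝ, (∀ i j, W i j ≠ 0 → x i = x j) →
      ∀ i j, ∑ l, W i l ≠ 0 → ∑ l, W j l ≠ 0 → x i = x j) :
    OnesDominate W := by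
  refine onesDominate_of_centered hsymm hnn fun x hx => ?_
  set d : ι → ℝ := fun i => ∑ j, W i j with hd
  have hd0 : ∀ i, 0 ≤ d i := fun i => sum_nonneg fun j _ => hnn i j
  have hW0 : ∀ i, d i = 0 → ∀ j, W i j = 0 := fun i hi j =>
    (sum_eq_zero_iff_of_nonneg fun j _ => hnn i j).1 hi j (mem_univ j)
  set s : ι → ℝ := fun i => √(d i) with hs
  have hss : ∀ i, s i * s i = d i := fun i => Real.mul_self_sqrt (hd0 i)
  have hsW : ∀ i, s i = 0 → ∀ j, W i j = 0 := fun i hi => hW0 i (by rw [← hss, hi, zero_mul])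
  let A : Matrix ι ι ℝ := Matrix.of fun i j => W i j / (s i * s j)
  have hA : A.IsSymm := by
    ext i j
    simp only [A, Matrix.transpose_apply, Matrix.of_apply]
    rw [hsymm, mul_comm]
  have hAy : ∀ (y : ι → ℝ) i, A.mulVec y i = (∑ j, W i j * (y j / s j)) / s i := by
    intro y i
    simp only [Matrix.mulVec, dotProduct, A, Matrix.of_apply]
    rw [sum_div]
    refine sum_congr rfl fun j _ => ?_
    rw [mul_comm (s i), ← div_div]
    ring
  have hyAy : ∀ y : ι → ℝ, y ⬝ᵥ A.mulVec y = ∑ i, ∑ j, W i j * (y i / s i) * (y j / s j) := by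
    intro y
    refine sum_congr rfl fun i _ => ?_
    rw [hAy, mul_div_assoc', mul_sum, sum_div]
    refine sum_congr rfl fun j _ => ?_
    ring
  have hAyAy : ∀ y : ι → ℝ, y ⬝ᵥ A.mulVec y ≤ A.mulVec y ⬝ᵥ A.mulVec y := by
    intro y
    rw [hyAy]
    refine (hle fun i => y i / s i).trans_eq (sum_congr rfl fun i _ => ?_)
    rw [hAy]
    change _ / d i = _
    rw [← hss]
    ring
  obtain ⟨l, b, hb, hb1, hexp⟩ := exists_eigenbasis_dotProduct hA
  have hlap : ∀ y : ι → ℝ, ∑ i, ∑ j, W i j * (y i / s i - y j / s j) ^ 2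
      ≤ 2 * (y ⬝ᵥ y) - 2 * (y ⬝ᵥ A.mulVec y) := by
    intro y
    have h1 : ∑ i, ∑ j, W i j * (y i / s i) ^ 2 ≤ y ⬝ᵥ y := by
      refine sum_le_sum fun i _ => ?_
      rw [← sum_mul]
      change d i * _ ≤ _
      rw [← hss]
      by_cases h : s i = 0
      · rw [h, zero_mul, zero_mul]; exact mul_self_nonneg _
      · apply le_of_eq; field_simp
    have h2 : ∑ i, ∑ j, W i j * (y j / s j) ^ 2 ≤ y ⬝ᵥ y := by
      rw [sum_comm]
      refine le_trans (le_of_eq ?_) h1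
      exact sum_congr rfl fun i _ => sum_congr rfl fun j _ => by rw [hsymm]
    have h3 : ∑ i, ∑ j, W i j * (y i / s i - y j / s j) ^ 2
        = ∑ i, ∑ j, W i j * (y i / s i) ^ 2 + ∑ i, ∑ j, W i j * (y j / s j) ^ 2
          - 2 * ∑ i, ∑ j, W i j * (y i / s i) * (y j / s j) := by
      simp only [mul_sum, ← sum_sub_distrib, ← sum_add_distrib]
      refine sum_congr rfl fun i _ => sum_congr rfl fun j _ => ?_
      ring
    rw [h3, hyAy]
    linarith
  have hlapnn : ∀ y : ι → ℝ, 0 ≤ ∑ i, ∑ j, W i j * (y i / s i - y j / s j) ^ 2 := fun y =>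
    sum_nonneg fun i _ => sum_nonneg fun j _ => mul_nonneg (hnn i j) (sq_nonneg _)
  have heig : ∀ a (y : ι → ℝ), ∑ i, y i * s i = 0 → l a * (y ⬝ᵥ b a) ^ 2 ≤ 0 := by
    intro a y hy
    have e1 : b a ⬝ᵥ A.mulVec (b a) = l a := by
      rw [hb, dotProduct_smul, hb1, smul_eq_mul, mul_one]
    have e2 : A.mulVec (b a) ⬝ᵥ A.mulVec (b a) = l a ^ 2 := by
      rw [hb, dotProduct_smul, smul_dotProduct, hb1, smul_eq_mul, smul_eq_mul]; ring
    have i1 := hAyAy (b a)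
    have i2 := hlap (b a)
    have i3 := hlapnn (b a)
    rw [e1, e2] at i1
    rw [e1, hb1] at i2
    rcases le_or_gt (l a) 0 with h | h
    · exact mul_nonpos_of_nonpos_of_nonneg h (sq_nonneg _)
    have hl1 : l a = 1 := by nlinarith
    have hz : ∑ i, ∑ j, W i j * (b a i / s i - b a j / s j) ^ 2 = 0 := by
      rw [hl1] at i2; linarith
    have hc := hconn (fun i => b a i / s i) (fun i j hij => by
      have h1 := (sum_eq_zero_iff_of_nonneg fun i _ => sum_nonneg fun j _ =>
        mul_nonneg (hnn i j) (sq_nonneg _)).1 hz i (mem_univ i)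
      have h2 := (sum_eq_zero_iff_of_nonneg fun j _ =>
        mul_nonneg (hnn i j) (sq_nonneg _)).1 h1 j (mem_univ j)
      exact sub_eq_zero.1 (pow_eq_zero_iff two_ne_zero |>.1 ((mul_eq_zero.1 h2).resolve_left hij)))
    have hbs : ∀ i, b a i = s i * (b a i / s i) := by
      intro i
      by_cases h0 : s i = 0
      · have := congrFun (hb a) i
        rw [hAy, h0, div_zero, hl1, one_smul] at this
        rw [← this, zero_div, mul_zero]
      · field_simp
    have hyb : y ⬝ᵥ b a = 0 := by
      by_cases hex : ∃ i, d i ≠ 0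
      · obtain ⟨i₀, hi₀⟩ := hex
        have : y ⬝ᵥ b a = (∑ i, y i * s i) * (b a i₀ / s i₀) := by
          rw [sum_mul]
          refine sum_congr rfl fun i _ => ?_
          by_cases h0 : d i = 0
          · have : s i = 0 := by simp only [hs, h0, Real.sqrt_zero]
            rw [hbs i, this]; ring
          · rw [hbs i, hc i i₀ h0 hi₀]; ring
        rw [this, hy, zero_mul]
      · push Not at hex
        refine sum_eq_zero fun i _ => ?_
        have : s i = 0 := by simp only [hs, hex, Real.sqrt_zero]
        rw [hbs i, this]; ring
    rw [hyb]; simp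
  have hfin : ∑ i, ∑ j, W i j * x i * x j
      = (fun i => s i * x i) ⬝ᵥ A.mulVec fun i => s i * x i := by
    rw [hyAy]
    refine sum_congr rfl fun i _ => sum_congr rfl fun j _ => ?_
    by_cases hi : s i = 0
    · rw [hsW i hi]; ring
    by_cases hj : s j = 0
    · rw [hsymm, hsW j hj]; ring
    field_simp
  rw [hfin, hexp]
  refine sum_nonpos fun a _ => ?_
  rw [Matrix.dotProduct_mulVec, ← Matrix.mulVec_transpose, hA, hb, smul_dotProduct, smul_eq_mul,
    dotProduct_comm (b a)]
  refine le_trans (le_of_eq ?_) (heig a (fun i => s i * x i) ?_)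
  · ring
  · rw [← hx]
    refine sum_congr rfl fun i _ => ?_
    change _ = d i * x i
    rw [← hss]; ring

theorem onesDominate_of_links {ι : Type*} [Fintype ι] {W : ι → ι → ℝ} {t : ι → ι → ι → ℝ} {r : ℝ}
    (hr : 0 < r) (hsymm : ∀ i j, W i j = W j i) (hnn : ∀ i j, 0 ≤ W i j)
    (htnn : ∀ i j l, 0 ≤ t i j l) (ht₁ : ∀ i j l, t i j l = t l j i)
    (htW : ∀ i j, ∑ l, t i j l = r * W i j) (ht : ∀ i, OnesDominate (t i))
    (hconn : ∀ x : ι → ℝ, (∀ i j, W i j ≠ 0 → x i = x j) →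
      ∀ i j, ∑ l, W i l ≠ 0 → ∑ l, W j l ≠ 0 → x i = x j) :
    OnesDominate W := by
  refine onesDominate_of_quadForm_le hsymm hnn (fun x => ?_) hconn
  have hlink : ∀ i, ∑ j, ∑ l, t i j l * x j * x l
      ≤ r * ((∑ j, W i j * x j) ^ 2 / ∑ j, W i j) := by
    intro i
    have h := ht i x
    simp_rw [htW, mul_assoc r, ← mul_sum] at h
    have hd : 0 ≤ ∑ j, W i j := sum_nonneg fun j _ => hnn i j
    rcases hd.eq_or_lt with h0 | hpos
    · have hz : ∀ j l, t i j l = 0 := by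
        intro j l
        have h1 := (sum_eq_zero_iff_of_nonneg fun j _ => hnn i j).1 h0.symm j (mem_univ j)
        have h2 := htW i j
        rw [h1, mul_zero] at h2
        exact (sum_eq_zero_iff_of_nonneg fun l _ => htnn i j l).1 h2 l (mem_univ l)
      rw [← h0, div_zero, mul_zero]
      simp [hz]
    · rw [mul_div_assoc', le_div_iff₀ hpos]
      refine le_of_mul_le_mul_left ?_ hr
      nlinarith
  have hsum : ∑ i, ∑ j, ∑ l, t i j l * x j * x l = r * ∑ i, ∑ j, W i j * x i * x j := by
    rw [sum_comm, mul_sum]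
    refine sum_congr rfl fun j _ => ?_
    rw [sum_comm, mul_sum]
    refine sum_congr rfl fun l _ => ?_
    simp_rw [← sum_mul, ht₁ _ j l]
    rw [htW, hsymm]
    ring
  refine le_of_mul_le_mul_left ?_ hr
  rw [← hsum, mul_sum]
  exact sum_le_sum fun i _ => hlink i

/-- A family of `k`-element sets closed under basis exchange: the bases of a matroid of rank `k`
(or the empty family). -/
structure IsBaseFamily {α : Type*} [DecidableEq α] (B : Finset (Finset α)) (k : ℕ) : Prop where
  card_eq : ∀ S ∈ B, S.card = k
  exchange : ∀ S ∈ B, ∀ S' ∈ B, ∀ m ∈ S', m ∉ S → ∃ f ∈ S, f ∉ S' ∧ insert f (S'.erase m) ∈ B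

/-- The total `f`-mass of the members of `B` that contain `T`. -/
noncomputable def upMass {α : Type*} [DecidableEq α] (B : Finset (Finset α)) (f : Finset α → ℝ)
    (T : Finset α) : ℝ :=
  ∑ S ∈ B with T ⊆ S, f S

/-- The number of members of `B` that contain `T` and two further distinct elements `i`, `j`. -/
noncomputable def pairCount {α : Type*} [DecidableEq α] (B : Finset (Finset α)) (T : Finset α)
    (i j : α) : ℝ :=
  if (insert i (insert j T)).card = T.card + 2 then upMass B (fun _ => 1) (insert i (insert j T))
  else 0

section UpMass

variable {α : Type*} [DecidableEq α] {B : Finset (Finset α)} {k : ℕ}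

theorem upMass_nonneg {f : Finset α → ℝ} (hf : ∀ S, 0 ≤ f S) (T : Finset α) :
    0 ≤ upMass B f T := sum_nonneg fun S _ => hf S

theorem exists_of_upMass_ne_zero {f : Finset α → ℝ} {T : Finset α} (h : upMass B f T ≠ 0) :
    ∃ S ∈ B, T ⊆ S := by
  obtain ⟨S, hS, -⟩ := exists_ne_zero_of_sum_ne_zero h
  exact ⟨S, (mem_filter.1 hS).1, (mem_filter.1 hS).2⟩

theorem upMass_one_pos {T S : Finset α} (hS : S ∈ B) (hT : T ⊆ S) :
    0 < upMass B (fun _ => 1) T :=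
  sum_pos (fun _ _ => one_pos) ⟨S, mem_filter.2 ⟨hS, hT⟩⟩

theorem upMass_mono {f : Finset α → ℝ} (hf : ∀ S, 0 ≤ f S) {T T' : Finset α} (h : T ⊆ T') :
    upMass B f T' ≤ upMass B f T :=
  sum_le_sum_of_subset_of_nonneg
    (monotone_filter_right _ fun _ _ hS => h.trans hS) fun S _ _ => hf S

theorem upMass_of_card (hB : ∀ S ∈ B, S.card = k) (f : Finset α → ℝ) {T : Finset α}
    (hT : T.card = k) : upMass B f T = if T ∈ B then f T else 0 := by
  rw [upMass, sum_filter, ← sum_ite_eq' B T f]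
  refine sum_congr rfl fun S hS => ?_
  by_cases h : T ⊆ S
  · rw [if_pos h, if_pos (eq_of_subset_of_card_le h (by rw [hT, hB S hS])).symm]
  · rw [if_neg h, if_neg (fun h' => h h'.ge)]

theorem upMass_empty (f : Finset α → ℝ) : upMass B f ∅ = ∑ S ∈ B, f S := by
  simp [upMass]

theorem pairCount_symm (T : Finset α) (i j : α) : pairCount B T i j = pairCount B T j i := by
  rw [pairCount, pairCount, insert_comm]

theorem pairCount_nonneg (T : Finset α) (i j : α) : 0 ≤ pairCount B T i j := by
  unfold pairCount
  split_ifs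
  exacts [upMass_nonneg (fun _ => zero_le_one) _, le_rfl]

theorem card_insert_insert_eq_iff {T : Finset α} {i j : α} :
    (insert i (insert j T)).card = T.card + 2 ↔ i ∉ T ∧ j ∉ insert i T := by
  rw [insert_comm]
  have h1 := card_insert_le i T
  by_cases hi : i ∈ T
  · have := card_insert_le j T
    rw [insert_eq_of_mem hi]
    simp only [hi, not_true_eq_false, false_and, iff_false]
    omega
  · by_cases hj : j ∈ insert i T
    · rw [insert_eq_of_mem hj]
      simp only [hj, not_true_eq_false, and_false, iff_false]
      omega
    · rw [card_insert_of_notMem hj, card_insert_of_notMem hi]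
      simp only [hi, hj, not_false_eq_true, and_self]

theorem pairCount_ne_zero {T S : Finset α} {i j : α} (hS : S ∈ B) (hT : T ⊆ S) (hi : i ∈ S)
    (hj : j ∈ S) (hiT : i ∉ T) (hjT : j ∉ T) (hij : i ≠ j) : pairCount B T i j ≠ 0 := by
  rw [pairCount, if_pos (card_insert_insert_eq_iff.2 ⟨hiT, by simp [hij.symm, hjT]⟩)]
  exact (upMass_one_pos hS (insert_subset hi (insert_subset hj hT))).ne'

theorem exists_of_pairCount_ne_zero {T : Finset α} {i j : α} (h : pairCount B T i j ≠ 0) :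
    ∃ S ∈ B, T ⊆ S ∧ i ∈ S ∧ j ∈ S ∧ i ∉ T ∧ j ∉ T ∧ i ≠ j := by
  unfold pairCount at h
  split_ifs at h with hc
  · obtain ⟨S, hS, hT⟩ := exists_of_upMass_ne_zero h
    have := card_insert_insert_eq_iff.1 hc
    rw [insert_subset_iff, insert_subset_iff] at hT
    rw [mem_insert, not_or] at this
    exact ⟨S, hS, hT.2.2, hT.1, hT.2.1, this.1, this.2.2, this.2.1 ∘ Eq.symm⟩
  · exact absurd rfl h

variable [Fintype α]

theorem sum_upMass_insert (hB : ∀ S ∈ B, S.card = k) (f : Finset α → ℝ) (T : Finset α) :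
    ∑ i ∈ Tᶜ, upMass B f (insert i T) = ((k : ℝ) - T.card) * upMass B f T := by
  simp_rw [upMass, sum_filter, mul_sum]
  rw [sum_comm]
  refine sum_congr rfl fun S hS => ?_
  by_cases h : T ⊆ S
  · have : ∀ i, insert i T ⊆ S ↔ i ∈ S := fun i => by simp [insert_subset_iff, h]
    simp_rw [this, if_pos h]
    rw [← sum_filter, sum_const, nsmul_eq_mul]
    congr 1
    have : (Tᶜ.filter (· ∈ S)) = S \ T := by ext; simp [and_comm]
    rw [this, card_sdiff_of_subset h, Nat.cast_sub (card_le_card h), hB S hS]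
  · rw [if_neg h, mul_zero]
    exact sum_eq_zero fun i _ => if_neg fun h' => h ((subset_insert _ _).trans h')

theorem sum_pairCount_mul (T : Finset α) (g : α → α → ℝ) :
    ∑ i, ∑ j, pairCount B T i j * g i j
      = ∑ i ∈ Tᶜ, ∑ j ∈ (insert i T)ᶜ, upMass B (fun _ => 1) (insert j (insert i T)) * g i j := by
  rw [← sum_subset (subset_univ Tᶜ)]
  · refine sum_congr rfl fun i hi => ?_
    rw [← sum_subset (subset_univ (insert i T)ᶜ)]
    · refine sum_congr rfl fun j hj => ?_
      rw [pairCount, if_pos (card_insert_insert_eq_iff.2 ⟨mem_compl.1 hi, mem_compl.1 hj⟩),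
        insert_comm]
    · intro j _ hj
      rw [pairCount, if_neg (fun h => hj (mem_compl.2 (card_insert_insert_eq_iff.1 h).2)),
        zero_mul]
  · intro i _ hi
    refine sum_eq_zero fun j _ => ?_
    rw [pairCount, if_neg (fun h => hi (mem_compl.2 (card_insert_insert_eq_iff.1 h).1)), zero_mul]

theorem sum_pairCount (hB : ∀ S ∈ B, S.card = k) (T : Finset α) (i : α) :
    ∑ j, pairCount B T i j
      = if i ∈ T then 0 else ((k : ℝ) - T.card - 1) * upMass B (fun _ => 1) (insert i T) := by
  split_ifs with hi
  · refine sum_eq_zero fun j _ => ?_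
    rw [pairCount, if_neg (fun h => (card_insert_insert_eq_iff.1 h).1 hi)]
  · rw [← sum_subset (subset_univ (insert i T)ᶜ)]
    · have h := sum_upMass_insert hB (fun _ => 1) (insert i T)
      rw [card_insert_of_notMem hi, Nat.cast_add, Nat.cast_one, ← sub_sub] at h
      rw [← h]
      refine sum_congr rfl fun j hj => ?_
      rw [pairCount, if_pos (card_insert_insert_eq_iff.2 ⟨hi, mem_compl.1 hj⟩), insert_comm]
    · intro j _ hj
      rw [pairCount, if_neg (fun h => hj (mem_compl.2 (card_insert_insert_eq_iff.1 h).2))]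

theorem exists_of_sum_pairCount_ne_zero (hB : ∀ S ∈ B, S.card = k) {T : Finset α} {i : α}
    (h : ∑ j, pairCount B T i j ≠ 0) : i ∉ T ∧ ∃ S ∈ B, insert i T ⊆ S := by
  rw [sum_pairCount hB] at h
  by_cases hi : i ∈ T
  · rw [if_pos hi] at h; exact absurd rfl h
  · rw [if_neg hi] at h
    exact ⟨hi, exists_of_upMass_ne_zero (right_ne_zero_of_mul h)⟩

theorem IsBaseFamily.pairCount_connected (hB : IsBaseFamily B k) {T : Finset α}
    (hT : T.card + 2 ≤ k) (x : α → ℝ) (hx : ∀ i j, pairCount B T i j ≠ 0 → x i = x j) (i j : α)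
    (hi : ∑ l, pairCount B T i l ≠ 0) (hj : ∑ l, pairCount B T j l ≠ 0) : x i = x j := by
  by_cases hij : i = j
  · rw [hij]
  obtain ⟨hiT, S, hS, hiS⟩ := exists_of_sum_pairCount_ne_zero hB.card_eq hi
  obtain ⟨hjT, S', hS', hjS'⟩ := exists_of_sum_pairCount_ne_zero hB.card_eq hj
  rw [insert_subset_iff] at hiS hjS'
  have key : ∀ f ∈ S, f ∉ T → x i = x f := by
    intro f hf hfT
    by_cases h : i = f
    · rw [h]
    · exact hx _ _ (pairCount_ne_zero hS hiS.2 hiS.1 hf hiT hfT h)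
  obtain ⟨m, hm, hmT⟩ : ∃ m ∈ S', m ∉ insert j T := by
    apply exists_mem_notMem_of_card_lt_card
    rw [hB.card_eq S' hS', card_insert_of_notMem hjT]
    omega
  rw [mem_insert, not_or] at hmT
  by_cases hmS : m ∈ S
  · rw [key m hmS hmT.2]
    exact hx _ _ (pairCount_ne_zero hS' hjS'.2 hm hjS'.1 hmT.2 hjT hmT.1)
  · obtain ⟨f, hfS, hfS', hf⟩ := hB.exchange S hS S' hS' m hm hmS
    have hfT : f ∉ T := fun h => hfS' (hjS'.2 h)
    rw [key f hfS hfT]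
    refine hx _ _ (pairCount_ne_zero hf ?_ (mem_insert_self _ _) ?_ hfT hjT ?_)
    · exact fun a ha => mem_insert_of_mem (mem_erase.2 ⟨fun h => hmT.2 (h ▸ ha), hjS'.2 ha⟩)
    · exact mem_insert_of_mem (mem_erase.2 ⟨Ne.symm hmT.1, hjS'.1⟩)
    · rintro rfl; exact hfS' hjS'.1

theorem IsBaseFamily.onesDominate_pairCount_of_card_eq (hB : IsBaseFamily B k) {T : Finset α}
    (hT : T.card + 2 = k) : OnesDominate (pairCount B T) := by
  have h01 : ∀ i j, pairCount B T i j = 0 ∨ pairCount B T i j = 1 := by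
    intro i j
    unfold pairCount
    split_ifs with h
    · rw [upMass_of_card hB.card_eq _ (h.trans hT)]
      split_ifs <;> simp
    · exact Or.inl rfl
  have h1 : ∀ i j, pairCount B T i j ≠ 0 → pairCount B T i j = 1 := fun i j =>
    (h01 i j).resolve_left
  refine onesDominate_of_multipartite (pairCount_symm T) h01 (fun i => ?_) ?_
  · by_contra h
    obtain ⟨-, -, -, -, -, -, -, h⟩ := exists_of_pairCount_ne_zero h
    exact h rfl
  · intro i l m q hil hmq
    obtain ⟨S, hS, hTS, hiS, hlS, hiT, hlT, hne⟩ :=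
      exists_of_pairCount_ne_zero (hil.trans_ne one_ne_zero)
    obtain ⟨S', hS', hTS', hmS', hqS', hmT, hqT, hne'⟩ :=
      exists_of_pairCount_ne_zero (hmq.trans_ne one_ne_zero)
    have hSeq : insert i (insert l T) = S := by
      refine eq_of_subset_of_card_le (insert_subset hiS (insert_subset hlS hTS)) ?_
      rw [hB.card_eq S hS, ← hT,
        card_insert_insert_eq_iff.2 ⟨hiT, by simp [hne.symm, hlT]⟩]
    by_cases hmi : m = i
    · right; rw [hmi, pairCount_symm]; exact hil
    by_cases hml : m = l
    · left; rw [hml]; exact hil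
    suffices ∃ f ∈ S, f ∉ T ∧ pairCount B T f m = 1 by
      obtain ⟨f, hf, hfT, h⟩ := this
      rw [← hSeq, mem_insert, mem_insert] at hf
      rcases hf with rfl | rfl | hf
      exacts [Or.inl h, Or.inr h, absurd hf hfT]
    by_cases hqS : q ∈ S
    · exact ⟨q, hqS, hqT, by rw [pairCount_symm]; exact hmq⟩
    · obtain ⟨f, hfS, hfS', hf⟩ := hB.exchange S hS S' hS' q hqS' hqS
      have hfT : f ∉ T := fun h => hfS' (hTS' h)
      refine ⟨f, hfS, hfT, h1 _ _ (pairCount_ne_zero hf ?_ (mem_insert_self _ _) ?_ hfT hmT ?_)⟩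
      · exact fun a ha => mem_insert_of_mem (mem_erase.2 ⟨fun h => hqT (h ▸ ha), hTS' ha⟩)
      · exact mem_insert_of_mem (mem_erase.2 ⟨hne', hmS'⟩)
      · rintro rfl; exact hfS' hmS'

theorem IsBaseFamily.onesDominate_pairCount (hB : IsBaseFamily B k) (T : Finset α)
    (hT : T.card + 2 ≤ k) : OnesDominate (pairCount B T) := by
  obtain ⟨r, hr⟩ := Nat.exists_eq_add_of_le hT
  induction r generalizing T with
  | zero => exact hB.onesDominate_pairCount_of_card_eq hr.symm
  | succ r ih =>
    set t : α → α → α → ℝ := fun i j l => if i ∈ T then 0 else pairCount B (insert i T) j l with ht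
    have htriple : ∀ i j l, t i j l = if (insert i (insert j (insert l T))).card = T.card + 3
        then upMass B (fun _ => 1) (insert i (insert j (insert l T))) else 0 := by
      intro i j l
      simp only [ht]
      split_ifs with hi hc hc
      · exfalso
        rw [insert_eq_of_mem (mem_insert_of_mem (mem_insert_of_mem hi))] at hc
        have h1 := card_insert_le j (insert l T)
        have h2 := card_insert_le l T
        omega
      · rfl
      · rw [pairCount, card_insert_of_notMem hi, insert_comm l i, insert_comm j i, if_pos hc]
      · rw [pairCount, card_insert_of_notMem hi, insert_comm l i, insert_comm j i, if_neg hc]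
    have hpos : (0 : ℝ) < r + 1 := by positivity
    refine onesDominate_of_links (t := t) hpos (pairCount_symm T) (pairCount_nonneg T)
      (fun i j l => ?_) (fun i j l => ?_) (fun i j => ?_) (fun i => ?_)
      (hB.pairCount_connected hT)
    · simp only [ht]
      split_ifs
      exacts [le_rfl, pairCount_nonneg _ _ _]
    · rw [htriple, htriple]
      have : insert i (insert j (insert l T)) = insert l (insert j (insert i T)) := by
        ext; simp only [mem_insert]; tauto
      rw [this]
    · by_cases hi : i ∈ T
      · simp only [ht, if_pos hi, sum_const_zero]
        rw [pairCount, if_neg (fun h => (card_insert_insert_eq_iff.1 h).1 hi), mul_zero]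
      · simp only [ht, if_neg hi]
        rw [sum_pairCount hB.card_eq, pairCount, card_insert_of_notMem hi]
        have hk : (k : ℝ) = T.card + 2 + (r + 1) := by exact_mod_cast hr
        by_cases hj : j ∈ insert i T
        · rw [if_pos hj, if_neg (fun h => (card_insert_insert_eq_iff.1 h).2 hj), mul_zero]
        · rw [if_neg hj, if_pos (card_insert_insert_eq_iff.2 ⟨hi, hj⟩), hk, insert_comm]
          push_cast
          ring
    · by_cases hi : i ∈ T
      · simp only [ht, if_pos hi]
        intro x; simp
      · simp only [ht, if_neg hi]
        have hc := card_insert_of_notMem hi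
        exact ih (insert i T) (by omega) (by omega)

end UpMass

/-- The contribution of `T` to the relative entropy, at level `T.card`, of `f` with respect to the
uniform measure on `B`. -/
noncomputable def entTerm {α : Type*} [DecidableEq α] (B : Finset (Finset α)) (f : Finset α → ℝ)
    (T : Finset α) : ℝ :=
  upMass B f T * Real.log (upMass B f T / upMass B (fun _ => 1) T)

/-- The sum of `entTerm` over all sets of size `m`. -/
noncomputable def levelEnt {α : Type*} [DecidableEq α] [Fintype α] (B : Finset (Finset α))
    (f : Finset α → ℝ) (m : ℕ) : ℝ :=
  ∑ T ∈ powersetCard m univ, entTerm B f T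

section Entropy

variable {α : Type*} [DecidableEq α] {B : Finset (Finset α)} {k : ℕ} {f : Finset α → ℝ}

theorem upMass_eq_zero (f : Finset α → ℝ) {T : Finset α} (h : upMass B (fun _ => 1) T = 0) :
    upMass B f T = 0 := by
  by_contra h'
  obtain ⟨S, hS, hT⟩ := exists_of_upMass_ne_zero h'
  exact (upMass_one_pos hS hT).ne' h

theorem upMass_one_mul_div (f : Finset α → ℝ) (T : Finset α) :
    upMass B (fun _ => 1) T * (upMass B f T / upMass B (fun _ => 1) T) = upMass B f T := by
  by_cases h : upMass B (fun _ => 1) T = 0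
  · rw [upMass_eq_zero f h, h, zero_mul]
  · field_simp

theorem sub_le_mul_log_div {a b : ℝ} (ha : 0 < a) (hb : 0 < b) : a - b ≤ a * Real.log (a / b) := by
  have h := Real.log_le_sub_one_of_pos (div_pos hb ha)
  rw [← inv_div a b, Real.log_inv, inv_div] at h
  have h' := mul_le_mul_of_nonneg_left h ha.le
  have e : a * (b / a - 1) = b - a := by field_simp
  linarith

theorem upMass_mul_log_ge (hf : ∀ S, 0 ≤ f S) {T : Finset α} (hT : 0 < upMass B f T) (i l : α) :
    upMass B f (insert l (insert i T))
      - upMass B (fun _ => 1) (insert l (insert i T))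
        * (upMass B f (insert i T) / upMass B (fun _ => 1) (insert i T)
          * (upMass B f (insert l T) / upMass B (fun _ => 1) (insert l T)))
        * (upMass B (fun _ => 1) T / upMass B f T)
      ≤ upMass B f (insert l (insert i T))
        * (Real.log (upMass B f (insert l (insert i T))
              / upMass B (fun _ => 1) (insert l (insert i T)))
          + Real.log (upMass B f T / upMass B (fun _ => 1) T)
          - Real.log (upMass B f (insert i T) / upMass B (fun _ => 1) (insert i T))
          - Real.log (upMass B f (insert l T) / upMass B (fun _ => 1) (insert l T))) := by
  have hF := upMass_nonneg (B := B) hf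
  have hc := upMass_nonneg (B := B) (f := fun _ => 1) fun _ => zero_le_one
  rcases (hF (insert l (insert i T))).eq_or_lt with h0 | hU
  · rw [← h0, zero_mul, zero_sub, neg_nonpos]
    have := hF T
    have := hF (insert i T)
    have := hF (insert l T)
    have := hc T
    have := hc (insert i T)
    have := hc (insert l T)
    have := hc (insert l (insert i T))
    positivity
  · have hpos : ∀ {U}, 0 < upMass B f U → 0 < upMass B (fun _ => 1) U := fun {U} h =>
      (hc U).lt_of_ne fun h' => h.ne' (upMass_eq_zero f h'.symm)
    have hi : 0 < upMass B f (insert i T) := hU.trans_le (upMass_mono hf (subset_insert _ _))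
    have hl : 0 < upMass B f (insert l T) :=
      hU.trans_le (upMass_mono hf (insert_subset_insert _ (subset_insert _ _)))
    have cU := hpos hU
    have ci := hpos hi
    have cl := hpos hl
    have cT := hpos hT
    refine (sub_le_mul_log_div hU (by positivity)).trans_eq ?_
    congr 1
    rw [Real.log_div hU.ne' (by positivity), Real.log_mul (by positivity) (by positivity),
      Real.log_mul (by positivity) (by positivity), Real.log_mul (by positivity) (by positivity),
      Real.log_div hi.ne' ci.ne', Real.log_div hl.ne' cl.ne', Real.log_div cT.ne' hT.ne',
      Real.log_div hU.ne' cU.ne', Real.log_div hT.ne' cT.ne']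
    ring

variable [Fintype α]

theorem sum_pairs_comm (T : Finset α) (g : α → α → ℝ) :
    ∑ i ∈ Tᶜ, ∑ l ∈ (insert i T)ᶜ, g i l = ∑ i ∈ Tᶜ, ∑ l ∈ (insert i T)ᶜ, g l i := by
  refine sum_comm' fun i l => ?_
  simp only [mem_compl, mem_insert, not_or, eq_comm (a := i)]
  tauto

theorem sum_powersetCard_insert (m : ℕ) (g : Finset α → ℝ) :
    ∑ T ∈ powersetCard m univ, ∑ i ∈ Tᶜ, g (insert i T)
      = (m + 1) * ∑ U ∈ powersetCard (m + 1) univ, g U := by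
  have : ∀ U ∈ powersetCard (m + 1) (univ : Finset α), (m + 1 : ℝ) * g U = ∑ _i ∈ U, g U := by
    intro U hU
    rw [sum_const, nsmul_eq_mul, (mem_powersetCard.1 hU).2]
    push_cast; ring
  rw [mul_sum, sum_congr rfl this, sum_sigma', sum_sigma']
  refine sum_bij' (fun p _ => ⟨insert p.2 p.1, p.2⟩) (fun p _ => ⟨p.1.erase p.2, p.2⟩)
    ?_ ?_ ?_ ?_ ?_
  · rintro ⟨T, i⟩ h
    simp only [mem_sigma, mem_powersetCard_univ, mem_compl] at h ⊢
    exact ⟨by rw [card_insert_of_notMem h.2, h.1], mem_insert_self _ _⟩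
  · rintro ⟨U, i⟩ h
    simp only [mem_sigma, mem_powersetCard_univ, mem_compl] at h ⊢
    exact ⟨by rw [card_erase_of_mem h.2, h.1, Nat.add_sub_cancel], notMem_erase _ _⟩
  · rintro ⟨T, i⟩ h
    simp only [mem_sigma, mem_compl] at h
    simp only [erase_insert h.2]
  · rintro ⟨U, i⟩ h
    simp only [mem_sigma] at h
    simp only [insert_erase h.2]
  · rintro ⟨T, i⟩ h
    rfl

theorem IsBaseFamily.sum_pairs_entTerm_ge (hB : IsBaseFamily B k) (hf : ∀ S, 0 ≤ f S)
    {T : Finset α} (hT : T.card + 2 ≤ k) :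
    0 ≤ ∑ i ∈ Tᶜ, ∑ l ∈ (insert i T)ᶜ, entTerm B f (insert l (insert i T))
      - 2 * ((k : ℝ) - T.card - 1) * ∑ i ∈ Tᶜ, entTerm B f (insert i T)
      + ((k : ℝ) - T.card) * ((k : ℝ) - T.card - 1) * entTerm B f T := by
  have hF := upMass_nonneg (B := B) hf
  rcases (hF T).eq_or_lt with h0 | hpos
  · have hz : ∀ U, T ⊆ U → entTerm B f U = 0 := fun U hU => by
      rw [entTerm, le_antisymm ((upMass_mono hf hU).trans_eq h0.symm) (hF U), zero_mul]
    rw [sum_eq_zero (fun i _ => hz _ (subset_insert _ _)), hz T Subset.rfl,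
      sum_eq_zero (fun i _ => sum_eq_zero fun l _ =>
        hz _ ((subset_insert _ _).trans (subset_insert _ _)))]
    simp
  set r : ℝ := (k : ℝ) - T.card with hr
  have hr2 : 2 ≤ r := by
    have : ((T.card + 2 : ℕ) : ℝ) ≤ k := by exact_mod_cast hT
    push_cast at this
    linarith
  have hcard : ∀ i ∈ Tᶜ, (k : ℝ) - (insert i T).card = r - 1 := fun i hi => by
    rw [card_insert_of_notMem (mem_compl.1 hi)]; push_cast; ring
  have hone : ∀ (g : Finset α → ℝ), ∀ i ∈ Tᶜ,
      ∑ l ∈ (insert i T)ᶜ, upMass B g (insert l (insert i T)) = (r - 1) * upMass B g (insert i T) :=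
    fun g i hi => by rw [sum_upMass_insert hB.card_eq, hcard i hi]
  have htwo : ∀ (g : Finset α → ℝ), ∑ i ∈ Tᶜ, ∑ l ∈ (insert i T)ᶜ,
      upMass B g (insert l (insert i T)) = (r - 1) * (r * upMass B g T) := fun g => by
    rw [sum_congr rfl (hone g), ← mul_sum, sum_upMass_insert hB.card_eq]
  set c : Finset α → ℝ := upMass B (fun _ => 1) with hc
  set F : Finset α → ℝ := upMass B f with hFdef
  set φ : Finset α → ℝ := fun U => Real.log (F U / c U) with hφ
  have hcT : 0 < c T := (upMass_nonneg (fun _ => zero_le_one) T).lt_of_ne fun h =>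
    hpos.ne' (upMass_eq_zero f h.symm)
  have hdiag : ∑ i ∈ Tᶜ, ∑ l ∈ (insert i T)ᶜ, F (insert l (insert i T)) * φ (insert i T)
      = (r - 1) * ∑ i ∈ Tᶜ, entTerm B f (insert i T) := by
    rw [mul_sum]
    refine sum_congr rfl fun i hi => ?_
    rw [← sum_mul, hone f i hi, mul_assoc]
    rfl
  have hdiag' : ∑ i ∈ Tᶜ, ∑ l ∈ (insert i T)ᶜ, F (insert l (insert i T)) * φ (insert l T)
      = (r - 1) * ∑ i ∈ Tᶜ, entTerm B f (insert i T) := by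
    rw [sum_pairs_comm, ← hdiag]
    simp_rw [insert_comm]
  have hbase : ∑ i ∈ Tᶜ, ∑ l ∈ (insert i T)ᶜ, F (insert l (insert i T)) * φ T
      = r * (r - 1) * entTerm B f T := by
    simp_rw [← sum_mul]
    rw [htwo]
    change _ = r * (r - 1) * (F T * φ T)
    ring
  set Q := ∑ i ∈ Tᶜ, ∑ l ∈ (insert i T)ᶜ, c (insert l (insert i T))
      * (F (insert i T) / c (insert i T) * (F (insert l T) / c (insert l T))) with hQ
  have hQle : Q * (c T / F T) ≤ (r - 1) * (r * F T) := by
    have h := hB.onesDominate_pairCount T hT fun i => F (insert i T) / c (insert i T)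
    have hD : ∑ i, ∑ j, pairCount B T i j = (r - 1) * (r * c T) := by
      have := sum_pairCount_mul (B := B) T fun _ _ => 1
      simp only [mul_one] at this
      rw [this, htwo]
    have hL : ∑ i, (∑ j, pairCount B T i j) * (F (insert i T) / c (insert i T))
        = (r - 1) * (r * F T) := by
      rw [hr, hFdef, ← sum_upMass_insert hB.card_eq, mul_sum, ← hr]
      rw [← sum_subset (subset_univ Tᶜ)]
      · refine sum_congr rfl fun i hi => ?_
        rw [sum_pairCount hB.card_eq, if_neg (mem_compl.1 hi), mul_assoc, upMass_one_mul_div]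
      · intro i _ hi
        rw [sum_pairCount hB.card_eq, if_pos (by simpa using hi), zero_mul]
    have hQ' : ∑ i, ∑ j, pairCount B T i j * (F (insert i T) / c (insert i T))
        * (F (insert j T) / c (insert j T)) = Q := by
      simp_rw [mul_assoc]
      exact sum_pairCount_mul T _
    rw [hD, hL, hQ'] at h
    rw [mul_div_assoc', div_le_iff₀ hpos]
    have hrr : 0 < (r - 1) * r := by nlinarith
    refine le_of_mul_le_mul_left ?_ hrr
    nlinarith
  have hmain : ∑ i ∈ Tᶜ, ∑ l ∈ (insert i T)ᶜ, (F (insert l (insert i T))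
        - c (insert l (insert i T)) * (F (insert i T) / c (insert i T)
          * (F (insert l T) / c (insert l T))) * (c T / F T))
      ≤ ∑ i ∈ Tᶜ, ∑ l ∈ (insert i T)ᶜ, F (insert l (insert i T))
        * (φ (insert l (insert i T)) + φ T - φ (insert i T) - φ (insert l T)) :=
    sum_le_sum fun i _ => sum_le_sum fun l _ => upMass_mul_log_ge hf hpos i l
  simp only [mul_sub, mul_add, sum_sub_distrib, sum_add_distrib, ← sum_mul]
    at hmain hdiag hdiag' hbase
  rw [htwo] at hmain hbase
  rw [← hQ] at hmain
  have hent : ∑ i ∈ Tᶜ, ∑ l ∈ (insert i T)ᶜ, entTerm B f (insert l (insert i T))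
      = ∑ i ∈ Tᶜ, ∑ l ∈ (insert i T)ᶜ, F (insert l (insert i T)) * φ (insert l (insert i T)) := rfl
  rw [hent]
  linarith

theorem IsBaseFamily.levelEnt_convex (hB : IsBaseFamily B k) (hf : ∀ S, 0 ≤ f S) {m : ℕ}
    (hm : m + 2 ≤ k) :
    0 ≤ (m + 1) * (m + 2) * levelEnt B f (m + 2)
      - 2 * ((k : ℝ) - m - 1) * (m + 1) * levelEnt B f (m + 1)
      + ((k : ℝ) - m) * ((k : ℝ) - m - 1) * levelEnt B f m := by
  have h : 0 ≤ ∑ T ∈ powersetCard m (univ : Finset α),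
      (∑ i ∈ Tᶜ, ∑ l ∈ (insert i T)ᶜ, entTerm B f (insert l (insert i T))
      - 2 * ((k : ℝ) - m - 1) * ∑ i ∈ Tᶜ, entTerm B f (insert i T)
      + ((k : ℝ) - m) * ((k : ℝ) - m - 1) * entTerm B f T) := by
    refine sum_nonneg fun T hT => ?_
    have hc := (mem_powersetCard.1 hT).2
    have := hB.sum_pairs_entTerm_ge hf (T := T) (by omega)
    rwa [hc] at this
  rw [sum_add_distrib, sum_sub_distrib, ← mul_sum, ← mul_sum, sum_powersetCard_insert,
    sum_powersetCard_insert m fun U => ∑ l ∈ Uᶜ, entTerm B f (insert l U),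
    sum_powersetCard_insert] at h
  refine h.trans_eq ?_
  unfold levelEnt
  push_cast
  ring

theorem IsBaseFamily.levelEnt_contract (hB : IsBaseFamily B k) (hk : 1 ≤ k) (hf : ∀ S, 0 ≤ f S) :
    levelEnt B f (k - 1) - k * levelEnt B f 0 ≤ (k - 1) * (levelEnt B f k - levelEnt B f 0) := by
  set D : ℕ → ℝ := fun m => (m.factorial : ℝ) * (k - m).factorial * levelEnt B f m with hD
  have hconv : ∀ m, m + 2 ≤ k → D (m + 1) - D m ≤ D (m + 2) - D (m + 1) := by
    intro m hm
    obtain ⟨q, rfl⟩ := Nat.exists_eq_add_of_le hm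
    have h := hB.levelEnt_convex hf hm
    have e0 : m + 2 + q - m = q + 2 := by omega
    have e1 : m + 2 + q - (m + 1) = q + 1 := by omega
    have e2 : m + 2 + q - (m + 2) = q := by omega
    have hpos : (0 : ℝ) ≤ m.factorial * q.factorial := by positivity
    have h' := mul_nonneg hpos h
    simp only [hD, e0, e1, e2, Nat.factorial_succ]
    push_cast at h' ⊢
    linarith
  have hmono : ∀ m, m + 1 ≤ k → D (m + 1) - D m ≤ D k - D (k - 1) := by
    intro m hm
    obtain ⟨q, hq⟩ := Nat.exists_eq_add_of_le hm
    induction q generalizing m with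
    | zero =>
      have : k = m + 1 := by omega
      rw [this, Nat.add_sub_cancel]
    | succ q ih => exact (hconv m (by omega)).trans (ih (m + 1) (by omega) (by omega))
  have htel : D k - D 0 ≤ k * (D k - D (k - 1)) := by
    rw [← sum_range_sub]
    refine (sum_le_sum fun m hm => hmono m (by simpa using hm)).trans_eq ?_
    rw [sum_const, card_range, nsmul_eq_mul]
  obtain ⟨q, rfl⟩ := Nat.exists_eq_add_of_le' hk
  have e1 : q + 1 - q = 1 := by omega
  simp only [hD, Nat.add_sub_cancel, Nat.sub_self, Nat.sub_zero, e1, Nat.factorial_zero,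
    Nat.factorial_succ] at htel
  push_cast at htel ⊢
  have hqf : (0 : ℝ) < (q + 1) * q.factorial := by positivity
  refine le_of_mul_le_mul_left ?_ hqf
  linarith

end Entropy

section Walk

variable {α : Type*} [DecidableEq α] {B : Finset (Finset α)} {k : ℕ}

theorem sum_abs_sub_sq_le_sum_mul_log {ι : Type*} (s : Finset ι) {p q : ι → ℝ}
    (hp : ∀ i ∈ s, 0 ≤ p i) (hq : ∀ i ∈ s, 0 < q i) (hp1 : ∑ i ∈ s, p i = 1)
    (hq1 : ∑ i ∈ s, q i = 1) :
    (1 / 2 * ∑ i ∈ s, |p i - q i|) ^ 2 ≤ ∑ i ∈ s, p i * Real.log (p i / q i) := by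
  have hcs := sum_mul_sq_le_sq_mul_sq s (fun i => |√(p i) - √(q i)|) fun i => √(p i) + √(q i)
  have habs : ∑ i ∈ s, |√(p i) - √(q i)| * (√(p i) + √(q i)) = ∑ i ∈ s, |p i - q i| := by
    refine sum_congr rfl fun i hi => ?_
    have e : p i - q i = (√(p i) - √(q i)) * (√(p i) + √(q i)) := by
      linear_combination -Real.sq_sqrt (hp i hi) + Real.sq_sqrt (hq i hi).le
    rw [e, abs_mul, abs_of_nonneg (a := √(p i) + √(q i)) (by positivity)]
  have hsum : ∑ i ∈ s, (√(p i) + √(q i)) ^ 2 ≤ 4 := by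
    have : ∑ i ∈ s, (√(p i) + √(q i)) ^ 2 ≤ ∑ i ∈ s, (2 * p i + 2 * q i) := by
      refine sum_le_sum fun i hi => ?_
      nlinarith [sq_nonneg (√(p i) - √(q i)), Real.sq_sqrt (hp i hi), Real.sq_sqrt (hq i hi).le]
    rw [sum_add_distrib, ← mul_sum, ← mul_sum, hp1, hq1] at this
    linarith
  have hhel : ∑ i ∈ s, |√(p i) - √(q i)| ^ 2 ≤ ∑ i ∈ s, p i * Real.log (p i / q i) := by
    have : ∑ i ∈ s, |√(p i) - √(q i)| ^ 2
        ≤ ∑ i ∈ s, (p i * Real.log (p i / q i) - p i + q i) := by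
      refine sum_le_sum fun i hi => ?_
      rw [sq_abs]
      rcases (hp i hi).eq_or_lt with h0 | hpos
      · rw [← h0]; simp [Real.sq_sqrt (hq i hi).le]
      · have ha := Real.sqrt_pos.2 hpos
        have h := sub_le_mul_log_div ha (Real.sqrt_pos.2 (hq i hi))
        rw [← Real.sqrt_div hpos.le, Real.log_sqrt (div_pos hpos (hq i hi)).le] at h
        have h' := mul_le_mul_of_nonneg_left h (mul_nonneg zero_le_two ha.le)
        have e : 2 * √(p i) * (√(p i) * (Real.log (p i / q i) / 2))
            = p i * Real.log (p i / q i) := by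
          linear_combination Real.log (p i / q i) * Real.sq_sqrt hpos.le
        rw [e] at h'
        linarith [Real.sq_sqrt hpos.le, Real.sq_sqrt (hq i hi).le]
    rw [sum_add_distrib, sum_sub_distrib, hp1, hq1] at this
    linarith
  rw [habs] at hcs
  have h0 : 0 ≤ ∑ i ∈ s, |√(p i) - √(q i)| ^ 2 := sum_nonneg fun i _ => by positivity
  nlinarith [mul_le_mul_of_nonneg_left hsum h0]

theorem walkDist_zero (ground : Finset α) (μ : Finset α → ℝ) (S₀ S : Finset α) :
    walkDist ground k μ S₀ 0 S = if S = S₀ then 1 else 0 := rfl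

theorem walkDist_succ (ground : Finset α) (μ : Finset α → ℝ) (S₀ S' : Finset α) (t : ℕ) :
    walkDist ground k μ S₀ (t + 1) S'
      = ∑ S ∈ ground.powersetCard k, walkDist ground k μ S₀ t S * downUp ground k μ S S' := rfl

variable [Fintype α]

theorem sum_sdiff_singleton {S : Finset α} (hk : 1 ≤ k) (hS : S.card = k) (φ : Finset α → ℝ) :
    ∑ e ∈ S, φ (S \ {e}) = ∑ T ∈ powersetCard (k - 1) univ with T ⊆ S, φ T := by
  refine sum_bij (fun e _ => S \ {e}) (fun e he => ?_) (fun e he e' he' h => ?_) (fun T hT => ?_)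
    fun _ _ => rfl
  · rw [mem_filter, mem_powersetCard_univ, card_sdiff_of_subset (singleton_subset_iff.2 he), hS,
      card_singleton]
    exact ⟨rfl, sdiff_subset⟩
  · by_contra hne
    have : e ∈ S \ {e'} := by simp [he, hne]
    rw [← h] at this
    simp at this
  · rw [mem_filter, mem_powersetCard_univ] at hT
    have hc : (S \ T).card = 1 := by rw [card_sdiff_of_subset hT.2]; omega
    obtain ⟨e, he⟩ := card_eq_one.1 hc
    have heS : e ∈ S := (mem_sdiff.1 (he ▸ mem_singleton_self e)).1
    exact ⟨e, heS, by rw [← he, Finset.sdiff_sdiff_eq_self hT.2]⟩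

theorem sum_mul_sum_sdiff_singleton (hk : 1 ≤ k) (hB : ∀ S ∈ B, S.card = k)
    (f φ : Finset α → ℝ) :
    ∑ S ∈ B, f S * ∑ e ∈ S, φ (S \ {e}) = ∑ T ∈ powersetCard (k - 1) univ, upMass B f T * φ T := by
  simp_rw [upMass, sum_filter, sum_mul]
  rw [sum_comm]
  refine sum_congr rfl fun S hS => ?_
  rw [sum_sdiff_singleton hk (hB S hS), sum_filter, mul_sum]
  refine sum_congr rfl fun T _ => ?_
  split_ifs <;> ring

theorem sum_mul_downUp_s14 {ground : Finset α} {μ : Finset α → ℝ} (hk : 1 ≤ k)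
    (hBg : B ⊆ ground.powersetCard k) (hμ : ∀ S, μ S = if S ∈ B then 1 else 0)
    {f : Finset α → ℝ} (hf : ∀ S, S ∉ B → f S = 0) (S' : Finset α) :
    ∑ S ∈ ground.powersetCard k, f S * downUp ground k μ S S'
      = if S' ∈ B then ∑ e ∈ S', (1 / (k : ℝ))
          * (upMass B f (S' \ {e}) / upMass B (fun _ => 1) (S' \ {e})) else 0 := by
  have hB : ∀ S ∈ B, S.card = k := fun S hS => (mem_powersetCard.1 (hBg hS)).2
  have hden : ∀ T : Finset α, ∑ S'' ∈ (ground.powersetCard k).filter (fun S'' => T ⊆ S''), μ S''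
      = upMass B (fun _ => 1) T := by
    intro T
    rw [upMass, sum_filter, sum_filter]
    refine (sum_subset_zero_on_sdiff hBg (fun S hS => ?_) fun S hS => ?_).symm
    · rw [hμ, if_neg (mem_sdiff.1 hS).2, ite_self]
    · rw [hμ, if_pos hS]
  have hstep : ∑ S ∈ ground.powersetCard k, f S * downUp ground k μ S S'
      = 1 / (k : ℝ) * ∑ S ∈ B, f S * ∑ e ∈ S, (fun T => if T ⊆ S' then
          μ S' / upMass B (fun _ => 1) T else 0) (S \ {e}) := by
    rw [mul_sum]
    refine (sum_subset_zero_on_sdiff hBg (fun S hS => ?_) fun S hS => ?_).symm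
    · rw [hf S (mem_sdiff.1 hS).2, zero_mul]
    · rw [downUp, if_neg (by rw [hμ, if_pos hS]; exact one_ne_zero)]
      simp_rw [hden]
      ring
  rw [hstep, sum_mul_sum_sdiff_singleton hk hB f fun T => if T ⊆ S' then
    μ S' / upMass B (fun _ => 1) T else 0]
  split_ifs with h
  · rw [← mul_sum]
    congr 1
    rw [sum_sdiff_singleton hk (hB S' h) fun T => upMass B f T / upMass B (fun _ => 1) T,
      sum_filter]
    refine sum_congr rfl fun T _ => ?_
    rw [hμ, if_pos h]
    split_ifs <;> ring
  · rw [sum_eq_zero, mul_zero]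
    intro T _
    rw [hμ, if_neg h]
    simp

theorem levelEnt_zero (f : Finset α → ℝ) (hf : ∑ S ∈ B, f S = 1) :
    levelEnt B f 0 = -Real.log B.card := by
  simp [levelEnt, entTerm, upMass_empty, hf]

theorem levelEnt_top (hB : ∀ S ∈ B, S.card = k) (f : Finset α → ℝ) :
    levelEnt B f k = ∑ S ∈ B, f S * Real.log (f S) := by
  have hsub : B ⊆ powersetCard k univ := fun S hS => mem_powersetCard_univ.2 (hB S hS)
  refine (sum_subset_zero_on_sdiff hsub (fun S hS => ?_) fun S hS => ?_).symm
  · rw [mem_sdiff, mem_powersetCard_univ] at hS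
    rw [entTerm, upMass_of_card hB f hS.1, if_neg hS.2, zero_mul]
  · rw [entTerm, upMass_of_card hB f (hB S hS), upMass_of_card hB _ (hB S hS), if_pos hS, if_pos hS,
      div_one]

theorem IsBaseFamily.walkDist_entropy (hB : IsBaseFamily B k) {ground : Finset α}
    {μ : Finset α → ℝ} (hk : 1 ≤ k) (hBg : B ⊆ ground.powersetCard k)
    (hμ : ∀ S, μ S = if S ∈ B then 1 else 0) {S₀ : Finset α} (hS₀ : S₀ ∈ B) (t : ℕ) :
    (∀ S, 0 ≤ walkDist ground k μ S₀ t S) ∧ (∀ S, S ∉ B → walkDist ground k μ S₀ t S = 0) ∧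
      ∑ S ∈ B, walkDist ground k μ S₀ t S = 1 ∧
      (∑ S ∈ B, walkDist ground k μ S₀ t S * Real.log (walkDist ground k μ S₀ t S))
        + Real.log B.card ≤ (1 - 1 / (k : ℝ)) ^ t * Real.log B.card := by
  have hk0 : (0 : ℝ) < k := by exact_mod_cast hk
  induction t with
  | zero =>
    simp only [walkDist_zero]
    refine ⟨fun S => by split_ifs <;> norm_num,
      fun S hS => if_neg fun h : S = S₀ => hS (h ▸ hS₀), ?_, ?_⟩
    · rw [sum_ite_eq' B S₀, if_pos hS₀]
    · rw [sum_eq_zero fun S _ => by split_ifs <;> simp]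
      simp
  | succ t ih =>
    obtain ⟨hnn, hsupp, hmass, hent⟩ := ih
    set f : Finset α → ℝ := walkDist ground k μ S₀ t with hf
    have hstep : ∀ S', walkDist ground k μ S₀ (t + 1) S' = if S' ∈ B then ∑ e ∈ S', (1 / (k : ℝ))
          * (upMass B f (S' \ {e}) / upMass B (fun _ => 1) (S' \ {e})) else 0 := fun S' => by
      rw [walkDist_succ, sum_mul_downUp_s14 hk hBg hμ hsupp]
    have hrat : ∀ T, 0 ≤ upMass B f T / upMass B (fun _ => 1) T := fun T =>
      div_nonneg (upMass_nonneg hnn T) (upMass_nonneg (fun _ => zero_le_one) T)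
    refine ⟨fun S => ?_, fun S hS => by rw [hstep, if_neg hS], ?_, ?_⟩
    · rw [hstep]
      split_ifs
      · exact sum_nonneg fun e _ => mul_nonneg (by positivity) (hrat _)
      · exact le_rfl
    · have h1 := sum_mul_sum_sdiff_singleton hk hB.card_eq (fun _ => 1)
        fun T => upMass B f T / upMass B (fun _ => 1) T
      have h2 := sum_mul_sum_sdiff_singleton hk hB.card_eq f fun _ => 1
      simp only [upMass_one_mul_div, one_mul, mul_one, sum_const, nsmul_eq_mul] at h1 h2
      rw [sum_congr rfl fun S hS => by rw [hstep, if_pos hS, ← mul_sum], ← mul_sum, h1, ← h2,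
        sum_congr rfl fun S hS => by rw [hB.card_eq S hS], ← sum_mul, hmass]
      field_simp
    · have hjensen : ∑ S ∈ B, walkDist ground k μ S₀ (t + 1) S
          * Real.log (walkDist ground k μ S₀ (t + 1) S) ≤ 1 / (k : ℝ) * levelEnt B f (k - 1) := by
        have h1 := sum_mul_sum_sdiff_singleton hk hB.card_eq (fun _ => 1) fun T =>
          (upMass B f T / upMass B (fun _ => 1) T)
            * Real.log (upMass B f T / upMass B (fun _ => 1) T)
        simp only [← mul_assoc, upMass_one_mul_div, one_mul] at h1
        rw [levelEnt]
        simp only [entTerm]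
        rw [← h1, mul_sum]
        refine sum_le_sum fun S hS => ?_
        rw [hstep, if_pos hS, mul_sum]
        refine Real.convexOn_mul_log.map_sum_le (t := S) (w := fun _ => 1 / (k : ℝ))
          (p := fun e => upMass B f (S \ {e}) / upMass B (fun _ => 1) (S \ {e}))
          (fun _ _ => by positivity) ?_ fun e _ => hrat _
        rw [sum_const, nsmul_eq_mul, hB.card_eq S hS]
        field_simp
      have hcon := hB.levelEnt_contract hk hnn
      rw [levelEnt_zero f hmass, levelEnt_top hB.card_eq] at hcon
      have h3 : 1 / (k : ℝ) * levelEnt B f (k - 1) + Real.log B.card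
          ≤ (1 - 1 / (k : ℝ)) * ((∑ S ∈ B, f S * Real.log (f S)) + Real.log B.card) := by
        refine le_of_mul_le_mul_left ?_ hk0
        have e1 : (k : ℝ) * (1 / (k : ℝ) * levelEnt B f (k - 1) + Real.log B.card)
            = levelEnt B f (k - 1) + k * Real.log B.card := by field_simp
        have e2 : ∀ X : ℝ, (k : ℝ) * ((1 - 1 / (k : ℝ)) * X) = (k - 1) * X := fun X => by
          field_simp
        rw [e1, e2]
        linarith
      have hk1 : (0 : ℝ) ≤ 1 - 1 / (k : ℝ) := by
        rw [sub_nonneg, div_le_one hk0]; exact_mod_cast hk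
      calc _ ≤ 1 / (k : ℝ) * levelEnt B f (k - 1) + Real.log B.card := by linarith
        _ ≤ _ := h3
        _ ≤ (1 - 1 / (k : ℝ)) * ((1 - 1 / (k : ℝ)) ^ t * Real.log B.card) :=
          mul_le_mul_of_nonneg_left hent hk1
        _ = _ := by ring

theorem IsBaseFamily.tvDist_sq_le (hB : IsBaseFamily B k) {ground : Finset α}
    {μ : Finset α → ℝ} (hk : 1 ≤ k) (hBg : B ⊆ ground.powersetCard k)
    (hμ : ∀ S, μ S = if S ∈ B then 1 else 0) {S₀ : Finset α} (hS₀ : S₀ ∈ B) (t : ℕ) :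
    tvDist ground k (walkDist ground k μ S₀ t) (statDist ground k μ) ^ 2
      ≤ (1 - 1 / (k : ℝ)) ^ t * Real.log B.card := by
  obtain ⟨hnn, hsupp, hmass, hent⟩ := hB.walkDist_entropy hk hBg hμ hS₀ t
  have hN : (0 : ℝ) < B.card := by exact_mod_cast card_pos.2 ⟨S₀, hS₀⟩
  have hZ : ∑ S ∈ ground.powersetCard k, μ S = B.card := by
    rw [card_eq_sum_ones, Nat.cast_sum]
    refine (sum_subset_zero_on_sdiff hBg (fun S hS => ?_) fun S hS => ?_).symm
    · rw [hμ, if_neg (mem_sdiff.1 hS).2]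
    · rw [hμ, if_pos hS, Nat.cast_one]
  have htv : tvDist ground k (walkDist ground k μ S₀ t) (statDist ground k μ)
      = 1 / 2 * ∑ S ∈ B, |walkDist ground k μ S₀ t S - 1 / B.card| := by
    rw [tvDist]
    congr 1
    refine (sum_subset_zero_on_sdiff hBg (fun S hS => ?_) fun S hS => ?_).symm
    · rw [statDist, hμ, if_neg (mem_sdiff.1 hS).2, hsupp S (mem_sdiff.1 hS).2]; simp
    · rw [statDist, hZ, hμ, if_pos hS]
  rw [htv]
  refine (sum_abs_sub_sq_le_sum_mul_log B (fun S _ => hnn S) (fun _ _ => by positivity) hmass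
    ?_).trans (le_trans (le_of_eq ?_) hent)
  · rw [sum_const, nsmul_eq_mul]; field_simp
  · have hlog : Real.log B.card = ∑ S ∈ B, walkDist ground k μ S₀ t S * Real.log B.card := by
      rw [← sum_mul, hmass, one_mul]
    rw [hlog, ← sum_add_distrib]
    refine sum_congr rfl fun S _ => ?_
    rcases (hnn S).eq_or_lt with h | h
    · simp [← h]
    · rw [Real.log_div h.ne' (one_div_pos.2 hN).ne', Real.log_div one_ne_zero hN.ne', Real.log_one]
      ring

end Walk

section CoTree

variable {V : Type*} [Fintype V] {G : SimpleGraph V}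

theorem edgeSet_fromEdgeSet_of_subset [DecidableRel G.Adj] {X : Finset (Sym2 V)}
    (hX : X ⊆ G.edgeFinset) :
    (SimpleGraph.fromEdgeSet (X : Set (Sym2 V))).edgeSet = X := by
  rw [SimpleGraph.edgeSet_fromEdgeSet, sdiff_eq_left, Set.disjoint_left]
  intro e he hd
  exact G.not_isDiag_of_mem_edgeFinset (hX he) hd

theorem isTree_fromEdgeSet_iff [DecidableRel G.Adj] {X : Finset (Sym2 V)} (hX : X ⊆ G.edgeFinset) :
    (SimpleGraph.fromEdgeSet (X : Set (Sym2 V))).IsTree ↔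
      (SimpleGraph.fromEdgeSet (X : Set (Sym2 V))).Connected ∧ X.card + 1 = Fintype.card V := by
  rw [SimpleGraph.isTree_iff_connected_and_card, edgeSet_fromEdgeSet_of_subset hX]
  simp

variable [DecidableEq V]

/-- The `k`-element complements of spanning trees of `G`. -/
noncomputable def coTrees (G : SimpleGraph V) [DecidableRel G.Adj] (k : ℕ) :
    Finset (Finset (Sym2 V)) :=
  (G.edgeFinset.powersetCard k).filter fun S =>
    (SimpleGraph.fromEdgeSet ((G.edgeFinset \ S : Finset (Sym2 V)) : Set (Sym2 V))).IsTree

theorem coTreeIndicator_eq (G : SimpleGraph V) [DecidableRel G.Adj] (k : ℕ) (S : Finset (Sym2 V)) :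
    coTreeIndicator G k S = if S ∈ coTrees G k then 1 else 0 := by
  unfold coTreeIndicator
  refine if_congr ?_ rfl rfl
  rw [coTrees, mem_filter, mem_powersetCard, isTree_fromEdgeSet_iff sdiff_subset, and_assoc]
  refine and_congr_right fun _ => and_congr_right fun _ => ?_
  rw [and_comm]
  refine and_congr_right fun h => ?_
  have := Fintype.card_pos_iff.2 h.nonempty
  omega

theorem isBaseFamily_coTrees (G : SimpleGraph V) [DecidableRel G.Adj] (k : ℕ) :
    IsBaseFamily (coTrees G k) k where
  card_eq S hS := (mem_powersetCard.1 (mem_filter.1 hS).1).2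
  exchange S hS S' hS' m hm hmS := by
    rw [coTrees, mem_filter, mem_powersetCard] at hS hS'
    obtain ⟨⟨hSE, hSk⟩, hT⟩ := hS
    obtain ⟨⟨hSE', hSk'⟩, hT'⟩ := hS'
    have hT'c := (isTree_fromEdgeSet_iff sdiff_subset).1 hT'
    have hmE := hSE' hm
    set X := insert m (G.edgeFinset \ S') with hXdef
    have hX : X ⊆ G.edgeFinset := insert_subset hmE sdiff_subset
    set K := SimpleGraph.fromEdgeSet (X : Set (Sym2 V)) with hK
    have hKconn : K.Connected :=
      hT'c.1.mono (SimpleGraph.fromEdgeSet_mono (by exact_mod_cast subset_insert _ _))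
    have hXcard : X.card = Fintype.card V := by
      rw [hXdef, card_insert_of_notMem (by simp [hm]), hT'c.2]
    have hcyc : ¬ K.IsAcyclic := fun h => by
      have := ((isTree_fromEdgeSet_iff hX).1 ⟨hKconn, h⟩).2
      omega
    obtain ⟨v, p, hp⟩ : ∃ (v : V) (p : K.Walk v v), p.IsCycle := by
      by_contra hne
      push Not at hne
      exact hcyc fun v p => hne v p
    obtain ⟨f, hfp, hfT⟩ : ∃ f ∈ p.edges, f ∉ G.edgeFinset \ S := by
      by_contra hne
      push Not at hne
      refine hT.isAcyclic (p.transfer _ fun e he => ?_) (hp.transfer _)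
      rw [edgeSet_fromEdgeSet_of_subset sdiff_subset]
      exact_mod_cast hne e he
    have hfX : f ∈ X := by
      have := p.edges_subset_edgeSet hfp
      rwa [hK, edgeSet_fromEdgeSet_of_subset hX, mem_coe] at this
    have hfS : f ∈ S := by
      by_contra h
      exact hfT (mem_sdiff.2 ⟨hX hfX, h⟩)
    have hfm : f ≠ m := fun h => hmS (h ▸ hfS)
    have hfS' : f ∉ S' := (mem_sdiff.1 (mem_of_mem_insert_of_ne hfX hfm)).2
    have hdel : (K.deleteEdges {f}).Connected := by
      induction f with
      | h x y => exact hKconn.connected_delete_edge_of_not_isBridge fun hb =>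
          hb.notMem_edges_of_isCycle hp hfp
    have hcompl : G.edgeFinset \ insert f (S'.erase m) = X.erase f := by
      ext e
      simp only [hXdef, mem_sdiff, mem_insert, mem_erase]
      by_cases h : e = m
      · subst h; simp [hmE, hfm.symm]
      · simp [h]; tauto
    refine ⟨f, hfS, hfS', ?_⟩
    rw [coTrees, mem_filter, mem_powersetCard]
    refine ⟨⟨insert_subset (hX hfX) ((erase_subset _ _).trans hSE'), ?_⟩, ?_⟩
    · rw [card_insert_of_notMem (fun h => hfS' (mem_of_mem_erase h)), card_erase_of_mem hm, hSk']
      have := card_pos.2 ⟨m, hm⟩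
      omega
    · rw [isTree_fromEdgeSet_iff sdiff_subset, hcompl]
      refine ⟨?_, ?_⟩
      · rw [coe_erase, SimpleGraph.fromEdgeSet_sdiff]
        exact hdel
      · rw [card_erase_of_mem hfX, hXcard]
        have := card_pos.2 ⟨f, hfX⟩
        omega

end CoTree

theorem one_sub_inv_pow_mul_log_le {n k N t : ℕ} {ε : ℝ} (hk : 1 ≤ k) (hkn : k ≤ n) (hN : 1 ≤ N)
    (hNn : N ≤ 2 ^ n) (hε : 0 < ε)
    (ht : 2 * n * (Real.log n + Real.log (1 / ε) + 1) ≤ t) :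
    (1 - 1 / (k : ℝ)) ^ t * Real.log N ≤ ε ^ 2 := by
  have hk0 : (0 : ℝ) < k := by exact_mod_cast hk
  have hn1 : (1 : ℝ) ≤ n := by exact_mod_cast hk.trans hkn
  have hn0 : (0 : ℝ) < n := by linarith
  have hkn' : (k : ℝ) ≤ n := by exact_mod_cast hkn
  have hN0 : (0 : ℝ) < N := by exact_mod_cast hN
  have hlogN : Real.log N ≤ n := by
    have h1 : Real.log N ≤ Real.log (2 ^ n) := Real.log_le_log hN0 (by exact_mod_cast hNn)
    rw [Real.log_pow] at h1
    nlinarith [Real.log_two_lt_d9]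
  have hlogN0 : 0 ≤ Real.log N := Real.log_nonneg (by exact_mod_cast hN)
  have hk1 : (0 : ℝ) ≤ 1 - 1 / (k : ℝ) := by
    rw [sub_nonneg, div_le_one hk0]; exact_mod_cast hk
  have hL : 2 * (Real.log n + Real.log (1 / ε) + 1) ≤ t * (1 / (k : ℝ)) := by
    have h1 : 2 * (Real.log n + Real.log (1 / ε) + 1) ≤ t * (1 / (n : ℝ)) := by
      rw [mul_one_div, le_div_iff₀ hn0]; linarith
    refine h1.trans (mul_le_mul_of_nonneg_left ?_ (Nat.cast_nonneg t))
    exact one_div_le_one_div_of_le hk0 hkn'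
  have hexp : (1 - 1 / (k : ℝ)) ^ t ≤ (ε / n) ^ 2 := by
    calc (1 - 1 / (k : ℝ)) ^ t ≤ Real.exp (-(1 / (k : ℝ))) ^ t :=
          pow_le_pow_left₀ hk1 (Real.one_sub_le_exp_neg _) t
      _ = Real.exp (-(t * (1 / (k : ℝ)))) := by rw [← Real.exp_nat_mul]; ring_nf
      _ ≤ Real.exp (2 * Real.log (ε / n)) := by
          refine Real.exp_le_exp.2 ?_
          rw [Real.log_div hε.ne' hn0.ne']
          rw [one_div, Real.log_inv] at hL
          linarith
      _ = (ε / n) ^ 2 := by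
          rw [two_mul, Real.exp_add, Real.exp_log (by positivity)]; ring
  calc (1 - 1 / (k : ℝ)) ^ t * Real.log N ≤ (ε / n) ^ 2 * n :=
        mul_le_mul hexp hlogN hlogN0 (by positivity)
    _ = ε ^ 2 / n := by field_simp
    _ ≤ ε ^ 2 := div_le_self (by positivity) hn1

/-- **Sampling spanning trees via the down-up walk on the cographic matroid:** the down-up
walk on complements of spanning trees of a connected graph with `n` edges mixes in
`O(n log(n/ε))` steps from any spanning-tree complement. -/
theorem spanning_tree_down_up_mixing :
    ∃ C : ℝ, 0 < C ∧
      ∀ (V : Type) [Fintype V] [DecidableEq V] (G : SimpleGraph V) [DecidableRel G.Adj],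
        G.Connected →
        ∀ n k : ℕ, n = G.edgeFinset.card → 1 ≤ n →
          k = n - (Fintype.card V - 1) → 1 ≤ k →
          ∀ S₀ : Finset (Sym2 V), coTreeIndicator G k S₀ = 1 →
            ∀ ε : ℝ, 0 < ε → ε < 1 →
              ∀ t : ℕ, C * n * (Real.log n + Real.log (1 / ε) + 1) ≤ t →
                tvDist G.edgeFinset k
                    (walkDist G.edgeFinset k (coTreeIndicator G k) S₀ t)
                    (statDist G.edgeFinset k (coTreeIndicator G k)) ≤ ε := by
  refine ⟨2, two_pos, ?_⟩
  intro V _ _ G _ _ n k hn _ hkn hk S₀ hS₀ ε hε _ t ht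
  have hmem : S₀ ∈ coTrees G k := by
    by_contra h
    rw [coTreeIndicator_eq G, if_neg h] at hS₀
    exact zero_ne_one hS₀
  have hsub : coTrees G k ⊆ G.edgeFinset.powersetCard k := filter_subset _ _
  have hcard : (coTrees G k).card ≤ 2 ^ n := by
    rw [hn, ← card_powerset]
    exact card_le_card fun S hS => mem_powerset.2 (mem_powersetCard.1 (hsub hS)).1
  have hsq := ((isBaseFamily_coTrees G k).tvDist_sq_le hk hsub
    (coTreeIndicator_eq G k) hmem t).trans
    (one_sub_inv_pow_mul_log_le hk (by omega) (card_pos.2 ⟨S₀, hmem⟩) hcard hε ht)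
  exact le_of_sq_le_sq hsq hε.le
end
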